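/- arXiv:2001.04022 — 4 statements merged into one kernel-verified Lean document; each statement's English description precedes it below -/
import Mathlib

section
/- Let (W,S) be a finite Coxeter system with longest element w₀, and let J ⊆ S. Then Σ_{w ∈ X_J} (-1)^{l(w)} equals the number of elements w ∈ X_J such that w₀·w·W_J = w·W_J, where l is the length function on W. -/
open scoped Classical Pointwise

variable {B : Type*} [Fintype B]
variable {W : Type*} [Group W] [Fintype W]
variable {M : CoxeterMatrix B}

/-- The standard parabolic subgroup `W_J` of the Coxeter system `cs`,
generated by the simple reflections indexed by `J`. -/
def CoxParabolic (cs : CoxeterSystem M W) (J : Finset B) : Subgroup W :=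
  Subgroup.closure (cs.simple '' ↑J)

/-- The set `X_J` of distinguished (minimal length) left coset representatives
of `W_J` in `W`: the elements `w` with `l (w * s) > l w` for all simple `s` in `J`. -/
noncomputable def CoxX (cs : CoxeterSystem M W) (J : Finset B) : Finset W :=
  Finset.univ.filter fun w => ∀ j ∈ J, cs.length w < cs.length (w * cs.simple j)

/-- `D_J = Σ_{w ∈ X_J} (-1)^{l(w)}`. -/
noncomputable def CoxD (cs : CoxeterSystem M W) (J : Finset B) : ℤ :=
  ∑ w ∈ CoxX cs J, (-1) ^ cs.length w

namespace CoxeterSystem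

set_option linter.unusedSectionVars false

open Real Polynomial.Chebyshev

/-! ### The geometric representation -/

/-- The symmetric bilinear form of the geometric representation, normalized so that simple roots
have square `2`. -/
noncomputable def geomForm (M : CoxeterMatrix B) : LinearMap.BilinForm ℝ (B → ℝ) :=
  Matrix.toBilin' (Matrix.of fun i j => -2 * cos (π / M i j))

/-- The simple root indexed by `i`. -/
noncomputable def simpleRoot (i : B) : B → ℝ := Pi.single i 1

theorem simpleRoot_nonneg (i : B) : 0 ≤ (simpleRoot i : B → ℝ) :=
  Pi.single_nonneg.2 zero_le_one

theorem geomForm_simpleRoot (i j : B) :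
    geomForm M (simpleRoot i) (simpleRoot j) = -2 * cos (π / M i j) := by
  simp [geomForm, simpleRoot, Matrix.toBilin'_single]

theorem geomForm_simpleRoot_self (i : B) :
    geomForm M (simpleRoot i) (simpleRoot i) = 2 := by
  simp [geomForm_simpleRoot]

theorem geomForm_comm (x y : B → ℝ) : geomForm M x y = geomForm M y x := by
  simp only [geomForm, Matrix.toBilin'_apply, Matrix.of_apply]
  rw [Finset.sum_comm]
  refine Finset.sum_congr rfl fun i _ => Finset.sum_congr rfl fun j _ => ?_
  rw [M.symmetric]
  ring

/-- The reflection along the simple root indexed by `i`. -/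
noncomputable def geomRefl (M : CoxeterMatrix B) (i : B) : Module.End ℝ (B → ℝ) :=
  (Module.reflection (geomForm_simpleRoot_self (M := M) i)).toLinearMap

theorem geomRefl_apply (i : B) (x : B → ℝ) :
    geomRefl M i x = x - geomForm M (simpleRoot i) x • simpleRoot i := by
  simp [geomRefl, Module.reflection_apply]

theorem geomForm_geomRefl (i : B) (x y : B → ℝ) :
    geomForm M (geomRefl M i x) (geomRefl M i y) = geomForm M x y := by
  simp only [geomRefl_apply, map_sub, map_smul, LinearMap.sub_apply, LinearMap.smul_apply,
    smul_eq_mul, geomForm_simpleRoot_self, geomForm_comm x (simpleRoot i)]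
  ring

theorem geomRefl_isLiftable : M.IsLiftable (geomRefl M) := by
  intro i j
  rcases eq_or_ne i j with rfl | hij
  · rw [M.diagonal, pow_one]
    refine LinearMap.ext fun x => ?_
    exact Module.involutive_reflection (geomForm_simpleRoot_self (M := M) i) x
  generalize hm : M i j = m
  have hm1 : m ≠ 1 := hm ▸ M.off_diagonal i j hij
  have key := Module.reflection_mul_reflection_pow (geomForm_simpleRoot_self (M := M) i)
    (geomForm_simpleRoot_self (M := M) j) m
    (2 * cos (2 * (π / m))) (by
      rw [geomForm_simpleRoot, geomForm_simpleRoot, M.symmetric j i, hm, cos_two_mul]; ring)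
  have hpow : (geomRefl M i * geomRefl M j) ^ m =
      ((Module.reflection (geomForm_simpleRoot_self (M := M) i) *
        Module.reflection (geomForm_simpleRoot_self (M := M) j)) ^ m).toLinearMap := by
    refine LinearMap.ext fun x => ?_
    simp only [geomRefl]
    clear key hm hm1
    induction m generalizing x with
    | zero => simp
    | succ m ih => simp [pow_succ, ih, Module.End.mul_apply]
  rw [hpow]
  rcases Nat.eq_zero_or_pos m with rfl | hpos
  · simp; rfl
  rcases eq_or_ne m 2 with rfl | hm2
  · rw [key]
    refine LinearMap.ext fun z => ?_
    have h0 : geomForm M (simpleRoot i) (simpleRoot j) = 0 := by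
      simp [geomForm_simpleRoot, hm]
    have h0' : geomForm M (simpleRoot j) (simpleRoot i) = 0 := by rw [geomForm_comm, h0]
    have hc : cos (2 * (π / ((2 : ℕ) : ℝ))) = -1 := by
      rw [← cos_pi]; congr 1; push_cast; ring
    rw [hc]
    norm_num [h0, h0', S_eq_U_comp_half_mul_X]
    abel
  have hm3 : 3 ≤ m := by omega
  have hmR : (3 : ℝ) ≤ m := by exact_mod_cast hm3
  set θ : ℝ := 2 * (π / m) with hθ
  have hmθ : m * θ = 2 * π := by rw [hθ]; field_simp
  have hsin : sin θ ≠ 0 := by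
    refine (sin_pos_of_pos_of_lt_pi (by positivity) ?_).ne'
    rw [hθ, ← mul_div_assoc, div_lt_iff₀ (by positivity)]
    nlinarith [pi_pos]
  have hS (n : ℤ) : (S ℝ n).eval (2 * cos θ) = sin ((n + 1) * θ) / sin θ := by
    rw [eq_div_iff hsin, S_two_mul_real_cos]
  rcases Nat.even_or_odd' m with ⟨k, hk | hk⟩
  · have hk' : (k : ℝ) * θ = π := by rw [hk] at hmθ; push_cast at hmθ; linarith
    have hz : (S ℝ ((k : ℤ) - 1)).eval (2 * cos θ) = 0 := by
      rw [hS]; push_cast; rw [sub_add_cancel, hk', sin_pi, zero_div]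
    have e1 : ((m : ℤ) - 2) / 2 = k - 1 := by omega
    have e2 : ((m : ℤ) - 1) / 2 = k - 1 := by omega
    rw [key, e1, e2, hz]
    simp
    rfl
  · have hz : (S ℝ (k : ℤ)).eval (2 * cos θ) + (S ℝ ((k : ℤ) - 1)).eval (2 * cos θ) = 0 := by
      have : ((k : ℝ) + 1) * θ = 2 * π - k * θ := by
        rw [hk] at hmθ; push_cast at hmθ; linarith
      rw [hS, hS]
      push_cast
      rw [sub_add_cancel, this, sin_two_pi_sub]
      ring
    have e1 : ((m : ℤ) - 2) / 2 = k - 1 := by omega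
    have e2 : ((m : ℤ) - 1) / 2 = k := by omega
    have e3 : ((m : ℤ) - 3) / 2 = k - 1 := by omega
    have e4 : (m : ℤ) / 2 = k := by omega
    rw [key, e1, e2, e3, e4, hz]
    simp
    rfl

/-- The geometric representation of a Coxeter group. -/
noncomputable def geomRep (cs : CoxeterSystem M W) : W →* Module.End ℝ (B → ℝ) :=
  cs.lift ⟨geomRefl M, geomRefl_isLiftable⟩

variable (cs : CoxeterSystem M W)

theorem geomRep_simple (i : B) : cs.geomRep (cs.simple i) = geomRefl M i :=
  cs.lift_apply_simple geomRefl_isLiftable i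

theorem geomRep_simple_apply (i : B) (x : B → ℝ) :
    cs.geomRep (cs.simple i) x = x - geomForm M (simpleRoot i) x • simpleRoot i := by
  rw [geomRep_simple, geomRefl_apply]

theorem geomRep_simple_simpleRoot (i : B) :
    cs.geomRep (cs.simple i) (simpleRoot i) = -simpleRoot i := by
  rw [geomRep_simple_apply, geomForm_simpleRoot_self]
  module

theorem geomRep_mul_apply (w w' : W) (x : B → ℝ) :
    cs.geomRep (w * w') x = cs.geomRep w (cs.geomRep w' x) := by
  rw [map_mul, Module.End.mul_apply]

theorem geomRep_inv_apply_self (w : W) (x : B → ℝ) : cs.geomRep w⁻¹ (cs.geomRep w x) = x := by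
  rw [← geomRep_mul_apply, inv_mul_cancel, map_one, Module.End.one_apply]

theorem geomForm_geomRep (w : W) (x y : B → ℝ) :
    geomForm M (cs.geomRep w x) (cs.geomRep w y) = geomForm M x y := by
  induction w using cs.simple_induction_left generalizing x y with
  | one => simp
  | mul_simple_left w i ih =>
    rw [geomRep_mul_apply, geomRep_mul_apply, geomRep_simple, geomForm_geomRefl, ih]

/-! ### Positivity of roots -/

theorem geomRep_alternatingWord_simpleRoot {i j : B} {t : ℝ}
    (ht : geomForm M (simpleRoot i) (simpleRoot j) = -t) (k : ℕ) :
    cs.geomRep (cs.wordProd (alternatingWord i j k)) (simpleRoot i) =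
      if Even k then (S ℝ k).eval t • simpleRoot i + (S ℝ (k - 1)).eval t • simpleRoot j
      else (S ℝ k).eval t • simpleRoot j + (S ℝ (k - 1)).eval t • simpleRoot i := by
  have ht' : geomForm M (simpleRoot j) (simpleRoot i) = -t := by rw [geomForm_comm, ht]
  have hone {i j : B} (h : geomForm M (simpleRoot j) (simpleRoot i) = -t) :
      cs.geomRep (cs.simple j) (simpleRoot i) = simpleRoot i + t • simpleRoot j := by
    rw [geomRep_simple_apply, h]
    module
  induction k using Nat.twoStepInduction generalizing i j with
  | zero => simp [alternatingWord]
  | one => simp [alternatingWord, hone ht', add_comm]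
  | more k ih1 ih2 =>
    have h1 : cs.geomRep (cs.wordProd (alternatingWord i j (k + 2))) (simpleRoot i) =
        -cs.geomRep (cs.wordProd (alternatingWord i j k)) (simpleRoot i) +
          t • cs.geomRep (cs.wordProd (alternatingWord j i (k + 1))) (simpleRoot j) := by
      rw [alternatingWord_succ, List.concat_eq_append, wordProd_append, wordProd_singleton,
        geomRep_mul_apply, hone ht', map_add, map_smul, alternatingWord_succ,
        List.concat_eq_append, wordProd_append, wordProd_singleton, geomRep_mul_apply,
        geomRep_simple_simpleRoot, map_neg, geomRep_mul_apply]
    have e1 : (S ℝ ((k + 2 : ℕ) : ℤ)).eval t =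
        t * (S ℝ ((k + 1 : ℕ) : ℤ)).eval t - (S ℝ (k : ℤ)).eval t := by
      push_cast
      rw [S_add_two]
      simp
    have e2 : (S ℝ (((k + 1 : ℕ) : ℤ))).eval t =
        t * (S ℝ (k : ℤ)).eval t - (S ℝ ((k : ℤ) - 1)).eval t := by
      have := S_add_two ℝ ((k : ℤ) - 1)
      rw [show (k : ℤ) - 1 + 2 = ((k + 1 : ℕ) : ℤ) by push_cast; ring, sub_add_cancel] at this
      rw [this]
      simp
    have e3 : (((k + 2 : ℕ) : ℤ) - 1) = ((k + 1 : ℕ) : ℤ) := by push_cast; ring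
    have e4 : (((k + 1 : ℕ) : ℤ) - 1) = (k : ℤ) := by push_cast; ring
    rw [h1, ih1 ht ht', ih2 ht' ht, e1, e3, e4]
    by_cases hk : Even k
    · have : ¬Even (k + 1) := by simpa [Nat.even_add_one] using hk
      have : Even (k + 2) := by simpa [Nat.even_add] using hk
      simp only [*, if_true, if_false]
      module
    · have : Even (k + 1) := by simpa [Nat.even_add_one] using hk
      have : ¬Even (k + 2) := by simpa [Nat.even_add] using hk
      simp only [*, if_true, if_false]
      module

theorem eval_S_two_mul_cos_nonneg {m : ℕ} (hm : m ≠ 1) {n : ℕ} (hn : m ≠ 0 → n ≤ m) :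
    0 ≤ (S ℝ ((n : ℤ) - 1)).eval (2 * cos (π / m)) := by
  rcases eq_or_ne m 0 with rfl | h0
  · simp [S_eval_two]
  have hm2 : (2 : ℝ) ≤ m := by exact_mod_cast (show 2 ≤ m by omega)
  have hsin : 0 < sin (π / m) := by
    refine sin_pos_of_pos_of_lt_pi (by positivity) ?_
    rw [div_lt_iff₀ (by positivity)]
    nlinarith [pi_pos]
  have h := S_two_mul_real_cos (π / m) ((n : ℤ) - 1)
  have hnm : (n : ℝ) ≤ m := by exact_mod_cast hn h0
  have hnn : 0 ≤ sin (n * (π / m)) := by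
    refine sin_nonneg_of_nonneg_of_le_pi (by positivity) ?_
    rw [← mul_div_assoc, div_le_iff₀ (by positivity)]
    nlinarith [pi_pos]
  push_cast at h
  rw [sub_add_cancel] at h
  exact nonneg_of_mul_nonneg_left (h ▸ hnn) hsin

theorem exists_geomRep_alternatingWord_simpleRoot_eq {i j : B} (hij : i ≠ j) {k : ℕ}
    (hk : M i j ≠ 0 → k < M i j) :
    ∃ a b : ℝ, 0 ≤ a ∧ 0 ≤ b ∧ cs.geomRep (cs.wordProd (alternatingWord i j k)) (simpleRoot i) =
      a • simpleRoot i + b • simpleRoot j := by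
  have h1 : 0 ≤ (S ℝ (k : ℤ)).eval (2 * cos (π / M i j)) := by
    simpa using eval_S_two_mul_cos_nonneg (M.off_diagonal i j hij) (n := k + 1) hk
  have h2 := eval_S_two_mul_cos_nonneg (M.off_diagonal i j hij) (n := k) fun h => (hk h).le
  rw [cs.geomRep_alternatingWord_simpleRoot
    ((geomForm_simpleRoot (M := M) i j).trans (neg_mul _ _))]
  split_ifs
  · exact ⟨_, _, h1, h2, rfl⟩
  · exact ⟨_, _, h2, h1, add_comm _ _⟩

/-- Every element without right descent at `i` factors as a left factor without right descents
at `i` and `j` times an alternating word in `i` and `j`, with lengths adding up. -/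
theorem exists_mul_alternatingWord (w : W) (i j : B) (hi : ¬cs.IsRightDescent w i) :
    ∃ (k : ℕ) (y : W), w = y * cs.wordProd (alternatingWord i j k) ∧
      cs.length w = cs.length y + k ∧ ¬cs.IsRightDescent y i ∧ ¬cs.IsRightDescent y j ∧
      (cs.IsRightDescent w j → 0 < k) := by
  induction hn : cs.length w using Nat.strong_induction_on generalizing w i j with
  | _ n ih =>
    by_cases hj : cs.IsRightDescent w j
    · have hl := cs.isRightDescent_iff.1 hj
      obtain ⟨k, y, h1, h2, h3, h4, -⟩ := ih _ (by omega) (w * cs.simple j) j i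
        (cs.isRightDescent_iff_not_isRightDescent_mul.1 hj) rfl
      refine ⟨k + 1, y, ?_, by omega, h4, h3, fun _ => k.succ_pos⟩
      rw [alternatingWord_succ, List.concat_eq_append, wordProd_append, wordProd_singleton,
        ← mul_assoc, ← h1, simple_mul_simple_cancel_right]
    · exact ⟨0, w, by simp [alternatingWord], by omega, hi, hj, fun h => absurd h hj⟩

/-- The positivity theorem of Tits: if `l (w * s i) > l w`, then `w` maps the simple root of `i`
to a positive vector. -/
theorem geomRep_simpleRoot_nonneg (w : W) (i : B) (hi : ¬cs.IsRightDescent w i) :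
    0 ≤ cs.geomRep w (simpleRoot i) := by
  induction hn : cs.length w using Nat.strong_induction_on generalizing w i with
  | _ n ih =>
    rcases eq_or_ne w 1 with rfl | hw
    · simpa using simpleRoot_nonneg i
    obtain ⟨j, hj⟩ := cs.exists_rightDescent_of_ne_one hw
    have hij : i ≠ j := fun h => hi (h ▸ hj)
    obtain ⟨k, y, rfl, hl, hyi, hyj, hk⟩ := cs.exists_mul_alternatingWord w i j hi
    have hkM (h0 : M i j ≠ 0) : k < M i j := by
      by_contra! hlt
      have hred := cs.not_isReduced_alternatingWord j i (m := k + 1)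
        (by rwa [M.symmetric]) (by rw [M.symmetric]; omega)
      have h1 := cs.length_wordProd_le (alternatingWord j i (k + 1))
      have h2 := cs.not_isRightDescent_iff.1 hi
      have h3 := cs.length_mul_le y (cs.wordProd (alternatingWord j i (k + 1)))
      rw [IsReduced, length_alternatingWord] at hred
      rw [length_alternatingWord] at h1
      have h4 : y * cs.wordProd (alternatingWord i j k) * cs.simple i =
          y * cs.wordProd (alternatingWord j i (k + 1)) := by
        rw [alternatingWord_succ, List.concat_eq_append, wordProd_append, wordProd_singleton,
          mul_assoc]
      rw [h4] at h2
      omega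
    obtain ⟨a, b, ha, hb, hab⟩ := cs.exists_geomRep_alternatingWord_simpleRoot_eq hij hkM
    have := hk hj
    rw [geomRep_mul_apply, hab, map_add, map_smul, map_smul]
    exact add_nonneg (smul_nonneg ha (ih _ (by omega) y i hyi rfl))
      (smul_nonneg hb (ih _ (by omega) y j hyj rfl))

theorem geomRep_simpleRoot_nonpos (w : W) (i : B) (hi : cs.IsRightDescent w i) :
    cs.geomRep w (simpleRoot i) ≤ 0 := by
  have := cs.geomRep_simpleRoot_nonneg (w * cs.simple i) i
    (cs.isRightDescent_iff_not_isRightDescent_mul.1 hi)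
  rw [geomRep_mul_apply, geomRep_simple_simpleRoot, map_neg] at this
  exact neg_nonneg.1 this

theorem geomRep_injective : Function.Injective cs.geomRep := by
  rw [injective_iff_map_eq_one]
  intro w hw
  by_contra h
  obtain ⟨i, hi⟩ := cs.exists_rightDescent_of_ne_one h
  have := cs.geomRep_simpleRoot_nonpos w i hi i
  rw [hw] at this
  simp [simpleRoot] at this
  linarith

/-! ### Positive roots and strong exchange -/

/-- The finite set of positive roots. -/
noncomputable def posRoots : Finset (B → ℝ) :=
  (Finset.univ.image fun p : W × B => cs.geomRep p.1 (simpleRoot p.2)).filter (0 ≤ ·)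

variable {cs} in
theorem mem_posRoots {β : B → ℝ} :
    β ∈ cs.posRoots ↔ (∃ w i, cs.geomRep w (simpleRoot i) = β) ∧ 0 ≤ β := by
  simp [posRoots]

theorem simpleRoot_mem_posRoots (i : B) : simpleRoot i ∈ cs.posRoots :=
  mem_posRoots.2 ⟨⟨1, i, by simp⟩, simpleRoot_nonneg i⟩

variable {cs} in
theorem geomForm_self_of_mem_posRoots {β : B → ℝ} (hβ : β ∈ cs.posRoots) :
    geomForm M β β = 2 := by
  obtain ⟨⟨w, i, rfl⟩, -⟩ := mem_posRoots.1 hβ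
  rw [geomForm_geomRep, geomForm_simpleRoot_self]

variable {cs} in
theorem not_nonpos_of_mem_posRoots {β : B → ℝ} (hβ : β ∈ cs.posRoots) : ¬β ≤ 0 := by
  intro h
  have h2 := geomForm_self_of_mem_posRoots hβ
  rw [le_antisymm h (mem_posRoots.1 hβ).2] at h2
  simp at h2

variable {cs} in
theorem geomRep_nonneg_or_nonpos {β : B → ℝ} (hβ : β ∈ cs.posRoots) (w : W) :
    0 ≤ cs.geomRep w β ∨ cs.geomRep w β ≤ 0 := by
  obtain ⟨⟨x, i, rfl⟩, -⟩ := mem_posRoots.1 hβ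
  rw [← geomRep_mul_apply]
  by_cases h : cs.IsRightDescent (w * x) i
  · exact .inr (cs.geomRep_simpleRoot_nonpos _ _ h)
  · exact .inl (cs.geomRep_simpleRoot_nonneg _ _ h)

variable {cs} in
theorem geomRep_mem_posRoots {β : B → ℝ} (hβ : β ∈ cs.posRoots) {w : W}
    (h : 0 ≤ cs.geomRep w β) : cs.geomRep w β ∈ cs.posRoots := by
  obtain ⟨⟨x, i, rfl⟩, -⟩ := mem_posRoots.1 hβ
  exact mem_posRoots.2 ⟨⟨w * x, i, by rw [geomRep_mul_apply]⟩, h⟩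

variable {cs} in
theorem neg_geomRep_mem_posRoots {β : B → ℝ} (hβ : β ∈ cs.posRoots) {w : W}
    (h : cs.geomRep w β ≤ 0) : -cs.geomRep w β ∈ cs.posRoots := by
  obtain ⟨⟨x, i, rfl⟩, -⟩ := mem_posRoots.1 hβ
  refine mem_posRoots.2 ⟨⟨w * x * cs.simple i, i, ?_⟩, neg_nonneg.2 h⟩
  rw [geomRep_mul_apply, geomRep_simple_simpleRoot, map_neg, geomRep_mul_apply]

variable {cs} in
/-- A simple reflection permutes the positive roots other than its own simple root. -/
theorem geomRep_simple_mem_posRoots {β : B → ℝ} (hβ : β ∈ cs.posRoots) {i : B}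
    (hi : β ≠ simpleRoot i) : cs.geomRep (cs.simple i) β ∈ cs.posRoots := by
  refine geomRep_mem_posRoots hβ ?_
  refine (geomRep_nonneg_or_nonpos hβ _).resolve_right fun h => hi ?_
  have h0 := (mem_posRoots.1 hβ).2
  rw [geomRep_simple_apply] at h
  have hβi : β = β i • simpleRoot i := by
    ext j
    rcases eq_or_ne j i with rfl | hj
    · simp [simpleRoot]
    · have h1 := h j
      have h2 := h0 j
      simp only [simpleRoot, Pi.sub_apply, Pi.smul_apply, Pi.single_eq_of_ne hj, smul_zero,
        sub_zero, Pi.zero_apply] at h1 h2 ⊢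
      exact le_antisymm h1 h2
  have h2 := geomForm_self_of_mem_posRoots hβ
  have h3 : 0 ≤ β i := h0 i
  rw [hβi] at h2
  simp only [map_smul, LinearMap.smul_apply, geomForm_simpleRoot_self, smul_eq_mul] at h2
  have h4 : β i = 1 := by nlinarith
  rw [hβi, h4, one_smul]

/-- The reflection in `W` along a root `β` (and `1` if `β` is not a root). -/
noncomputable def rootRefl (β : B → ℝ) : W :=
  if h : ∃ w, ∀ z, cs.geomRep w z = z - geomForm M β z • β then h.choose else 1

variable {cs} in
theorem rootRefl_eq {β : B → ℝ} {w : W} (h : ∀ z, cs.geomRep w z = z - geomForm M β z • β) :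
    cs.rootRefl β = w := by
  have hex : ∃ w, ∀ z, cs.geomRep w z = z - geomForm M β z • β := ⟨w, h⟩
  rw [rootRefl, dif_pos hex]
  refine cs.geomRep_injective (LinearMap.ext fun z => ?_)
  rw [hex.choose_spec, h]

theorem rootRefl_simpleRoot (i : B) : cs.rootRefl (simpleRoot i) = cs.simple i :=
  rootRefl_eq (cs.geomRep_simple_apply i)

theorem geomRep_conj_apply {x w : W} {β : B → ℝ}
    (h : ∀ z, cs.geomRep x z = z - geomForm M β z • β) (z : B → ℝ) :
    cs.geomRep (w * x * w⁻¹) z = z - geomForm M (cs.geomRep w β) z • cs.geomRep w β := by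
  have hz : cs.geomRep w (cs.geomRep w⁻¹ z) = z := by
    rw [← geomRep_mul_apply, mul_inv_cancel, map_one, Module.End.one_apply]
  have hB : geomForm M β (cs.geomRep w⁻¹ z) = geomForm M (cs.geomRep w β) z := by
    rw [← cs.geomForm_geomRep w, hz]
  rw [geomRep_mul_apply, geomRep_mul_apply, h, map_sub, map_smul, hz, hB]

variable {cs} in
theorem geomRep_rootRefl {β : B → ℝ} (hβ : β ∈ cs.posRoots) (z : B → ℝ) :
    cs.geomRep (cs.rootRefl β) z = z - geomForm M β z • β := by
  obtain ⟨⟨x, i, rfl⟩, -⟩ := mem_posRoots.1 hβ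
  have h := cs.geomRep_conj_apply (w := x) (cs.geomRep_simple_apply i)
  rw [rootRefl_eq h, h]

variable {cs} in
theorem rootRefl_geomRep {β : B → ℝ} (hβ : β ∈ cs.posRoots) (w : W) :
    cs.rootRefl (cs.geomRep w β) = w * cs.rootRefl β * w⁻¹ :=
  rootRefl_eq (cs.geomRep_conj_apply (geomRep_rootRefl hβ))

variable {cs} in
theorem geomRep_rootRefl_self {β : B → ℝ} (hβ : β ∈ cs.posRoots) :
    cs.geomRep (cs.rootRefl β) β = -β := by
  rw [geomRep_rootRefl hβ, geomForm_self_of_mem_posRoots hβ]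
  module

variable {cs} in
theorem rootRefl_mul_self {β : B → ℝ} (hβ : β ∈ cs.posRoots) :
    cs.rootRefl β * cs.rootRefl β = 1 := by
  refine cs.geomRep_injective (LinearMap.ext fun z => ?_)
  rw [geomRep_mul_apply, geomRep_rootRefl hβ z, map_sub, map_smul, geomRep_rootRefl_self hβ,
    geomRep_rootRefl hβ, map_one, Module.End.one_apply]
  module

variable {cs} in
/-- The strong exchange condition. -/
theorem length_mul_rootRefl_lt {β : B → ℝ} (hβ : β ∈ cs.posRoots) {w : W}
    (h : cs.geomRep w β ≤ 0) : cs.length (w * cs.rootRefl β) < cs.length w := by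
  induction hn : cs.length w using Nat.strong_induction_on generalizing w β with
  | _ n ih =>
    have hw : w ≠ 1 := by
      rintro rfl
      exact not_nonpos_of_mem_posRoots hβ (by simpa using h)
    obtain ⟨i, hi⟩ := cs.exists_rightDescent_of_ne_one hw
    have hl := cs.isRightDescent_iff.1 hi
    rcases eq_or_ne β (simpleRoot i) with rfl | hβi
    · rw [rootRefl_simpleRoot]
      omega
    have hβ' := geomRep_simple_mem_posRoots hβ hβi
    have h1 := ih _ (by omega) hβ' (w := w * cs.simple i)
      (by rwa [← geomRep_mul_apply, simple_mul_simple_cancel_right]) rfl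
    rw [rootRefl_geomRep hβ, inv_simple, ← mul_assoc, ← mul_assoc,
      simple_mul_simple_cancel_right] at h1
    rcases cs.length_mul_simple (w * cs.rootRefl β) i with h2 | h2 <;> omega

variable {cs} in
theorem length_mul_rootRefl_lt_iff {β : B → ℝ} (hβ : β ∈ cs.posRoots) {w : W} :
    cs.length (w * cs.rootRefl β) < cs.length w ↔ cs.geomRep w β ≤ 0 := by
  refine ⟨fun h => ?_, length_mul_rootRefl_lt hβ⟩
  refine (geomRep_nonneg_or_nonpos hβ w).resolve_left fun h0 => ?_
  have h1 := length_mul_rootRefl_lt hβ (w := w * cs.rootRefl β)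
    (by rw [geomRep_mul_apply, geomRep_rootRefl_self hβ, map_neg]; exact neg_nonpos.2 h0)
  rw [mul_assoc, rootRefl_mul_self hβ, mul_one] at h1
  omega

/-! ### A regular linear functional anti-invariant under the longest element -/

variable {cs} in
theorem isRightDescent_of_forall_length_le {w₀ : W} (hw₀ : ∀ w, cs.length w ≤ cs.length w₀)
    (i : B) : cs.IsRightDescent w₀ i :=
  lt_of_le_of_ne (hw₀ _) (cs.length_mul_simple_ne w₀ i)

variable {cs} in
theorem geomRep_longest_nonpos {w₀ : W} (hw₀ : ∀ w, cs.length w ≤ cs.length w₀) {x : B → ℝ}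
    (hx : 0 ≤ x) : cs.geomRep w₀ x ≤ 0 := by
  have h : x = ∑ i, x i • simpleRoot i := by
    simpa [simpleRoot] using (Pi.basisFun ℝ B).sum_repr x |>.symm
  rw [h, map_sum]
  refine Finset.sum_nonpos fun i _ => ?_
  rw [map_smul]
  exact smul_nonpos_of_nonneg_of_nonpos (hx i)
    (cs.geomRep_simpleRoot_nonpos _ _ (isRightDescent_of_forall_length_le hw₀ i))

variable {cs} in
theorem longest_mul_self {w₀ : W} (hw₀ : ∀ w, cs.length w ≤ cs.length w₀) : w₀ * w₀ = 1 := by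
  by_contra h
  obtain ⟨i, hi⟩ := cs.exists_rightDescent_of_ne_one h
  have hi0 := cs.simpleRoot_mem_posRoots i
  have h1 := cs.geomRep_simpleRoot_nonpos _ _ hi
  have h2 := neg_geomRep_mem_posRoots hi0 (geomRep_longest_nonpos hw₀ (simpleRoot_nonneg i))
  have h3 := geomRep_longest_nonpos hw₀ (mem_posRoots.1 h2).2
  rw [map_neg, ← geomRep_mul_apply, neg_nonpos] at h3
  exact not_nonpos_of_mem_posRoots (geomRep_mem_posRoots hi0 h3) h1

variable {cs} in
theorem exists_regular_functional {w₀ : W} (hw₀ : ∀ w, cs.length w ≤ cs.length w₀) :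
    ∃ v : (B → ℝ) →ₗ[ℝ] ℝ, (∀ β ∈ cs.posRoots, 0 < v β) ∧
      ∀ x, v (cs.geomRep w₀ x) = -v x := by
  let u : (B → ℝ) →ₗ[ℝ] ℝ := ∑ i, LinearMap.proj i
  have hu (x : B → ℝ) : u x = ∑ i, x i := by simp [u]
  refine ⟨u - u ∘ₗ cs.geomRep w₀, fun β hβ => ?_, fun x => ?_⟩
  · have h1 := not_nonpos_of_mem_posRoots hβ
    have h0 := (mem_posRoots.1 hβ).2
    have h2 := geomRep_longest_nonpos hw₀ h0
    have h3 : 0 < u β := by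
      obtain ⟨i, hi⟩ := not_forall.1 h1
      rw [hu]
      exact Finset.sum_pos' (fun i _ => h0 i) ⟨i, Finset.mem_univ i, not_le.1 hi⟩
    have h4 : u (cs.geomRep w₀ β) ≤ 0 := by
      rw [hu]
      exact Finset.sum_nonpos fun i _ => h2 i
    simp only [LinearMap.sub_apply, LinearMap.comp_apply]
    linarith
  · simp only [LinearMap.sub_apply, LinearMap.comp_apply]
    rw [← geomRep_mul_apply, longest_mul_self hw₀, map_one, Module.End.one_apply, neg_sub]

/-! ### Divided difference operators on functions on the group -/

section DivDiff

variable (v : (B → ℝ) →ₗ[ℝ] ℝ)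

/-- The function on `W` obtained by evaluating a vector on the orbit of the functional `v`. -/
noncomputable def orbitEval : (B → ℝ) →ₗ[ℝ] W → ℝ :=
  LinearMap.pi fun x => v ∘ₗ cs.geomRep x⁻¹

theorem orbitEval_apply (y : B → ℝ) (x : W) : cs.orbitEval v y x = v (cs.geomRep x⁻¹ y) := rfl

theorem orbitEval_simple_mul (y : B → ℝ) (i : B) (x : W) :
    cs.orbitEval v y (cs.simple i * x) = cs.orbitEval v (cs.geomRep (cs.simple i) y) x := by
  rw [orbitEval_apply, orbitEval_apply, mul_inv_rev, inv_simple, geomRep_mul_apply]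

/-- The divided difference operator of the simple reflection `i`. -/
noncomputable def divDiff (i : B) : Module.End ℝ (W → ℝ) where
  toFun f x := (f x - f (cs.simple i * x)) / cs.orbitEval v (simpleRoot i) x
  map_add' f g := by ext x; simp only [Pi.add_apply]; ring
  map_smul' c f := by ext x; simp only [Pi.smul_apply, smul_eq_mul, RingHom.id_apply]; ring

theorem divDiff_apply (i : B) (f : W → ℝ) (x : W) :
    cs.divDiff v i f x = (f x - f (cs.simple i * x)) / cs.orbitEval v (simpleRoot i) x := rfl

theorem divDiff_one (i : B) : cs.divDiff v i 1 = 0 := by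
  ext x
  simp [divDiff_apply]

theorem divDiff_mul_self (i : B) : cs.divDiff v i * cs.divDiff v i = 0 := by
  refine LinearMap.ext fun f => funext fun x => ?_
  rw [Module.End.mul_apply, divDiff_apply, divDiff_apply, divDiff_apply, orbitEval_simple_mul,
    simple_mul_simple_cancel_left, geomRep_simple_simpleRoot, map_neg, Pi.neg_apply]
  simp only [div_neg, ← neg_div, neg_sub, sub_self, zero_div]
  rfl

variable {v} (hv : ∀ β ∈ cs.posRoots, 0 < v β)
include hv

variable {cs}

theorem orbitEval_simpleRoot_ne_zero (i : B) (x : W) : cs.orbitEval v (simpleRoot i) x ≠ 0 := by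
  rw [orbitEval_apply]
  have hi := cs.simpleRoot_mem_posRoots i
  rcases geomRep_nonneg_or_nonpos hi x⁻¹ with h | h
  · exact (hv _ (geomRep_mem_posRoots hi h)).ne'
  · have := hv _ (neg_geomRep_mem_posRoots hi h)
    rw [map_neg] at this
    exact (neg_pos.1 this).ne

theorem divDiff_orbitEval_mul (i : B) (y : B → ℝ) (g : W → ℝ) :
    cs.divDiff v i (cs.orbitEval v y * g) =
      cs.orbitEval v (cs.geomRep (cs.simple i) y) * cs.divDiff v i g +
        geomForm M (simpleRoot i) y • g := by
  ext x
  have h := orbitEval_simpleRoot_ne_zero hv i x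
  simp only [divDiff_apply, Pi.mul_apply, Pi.add_apply, Pi.smul_apply, smul_eq_mul,
    orbitEval_simple_mul, geomRep_simple_apply, map_sub, map_smul, Pi.sub_apply]
  field_simp
  ring

theorem divDiff_eq_zero_iff (i : B) (f : W → ℝ) :
    cs.divDiff v i f = 0 ↔ ∀ x, f (cs.simple i * x) = f x := by
  simp only [funext_iff, divDiff_apply, Pi.zero_apply, div_eq_zero_iff,
    orbitEval_simpleRoot_ne_zero hv, or_false, sub_eq_zero]
  exact forall_congr' fun x => eq_comm

theorem exists_orbitEval_ne {x y : W} (hxy : x ≠ y) :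
    ∃ z, cs.orbitEval v z x ≠ cs.orbitEval v z y := by
  by_contra! h
  have h1 : x⁻¹ * y ≠ 1 := fun h1 => hxy (inv_mul_eq_one.1 h1)
  obtain ⟨i, hi⟩ := cs.exists_rightDescent_of_ne_one h1
  have hi0 := cs.simpleRoot_mem_posRoots i
  have h2 := hv _ (neg_geomRep_mem_posRoots hi0 (cs.geomRep_simpleRoot_nonpos _ _ hi))
  have h3 := h (cs.geomRep y (simpleRoot i))
  rw [orbitEval_apply, orbitEval_apply, geomRep_inv_apply_self, ← geomRep_mul_apply] at h3
  have h4 := hv _ hi0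
  rw [map_neg, h3] at h2
  linarith

theorem adjoin_range_orbitEval : Algebra.adjoin ℝ (Set.range (cs.orbitEval v)) = ⊤ := by
  set A := Algebra.adjoin ℝ (Set.range (cs.orbitEval v))
  have hL (z : B → ℝ) : cs.orbitEval v z ∈ A := Algebra.subset_adjoin ⟨z, rfl⟩
  have hsingle (x : W) : (Pi.single x 1 : W → ℝ) ∈ A := by
    choose z hz using fun y : {y // x ≠ y} => exists_orbitEval_ne hv y.2
    have h : (Pi.single x 1 : W → ℝ) = ∏ y : {y // x ≠ y},
        (cs.orbitEval v (z y) x - cs.orbitEval v (z y) y)⁻¹ •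
          (cs.orbitEval v (z y) - algebraMap ℝ (W → ℝ) (cs.orbitEval v (z y) y)) := by
      ext y
      rw [Finset.prod_apply]
      rcases eq_or_ne x y with rfl | hxy
      · rw [Pi.single_eq_same, Finset.prod_eq_one fun y _ => ?_]
        simpa using inv_mul_cancel₀ (sub_ne_zero.2 (hz y))
      · rw [Pi.single_eq_of_ne' hxy, Finset.prod_eq_zero (Finset.mem_univ ⟨y, hxy⟩)]
        simp
    rw [h]
    exact A.prod_mem fun y _ => A.smul_mem (A.sub_mem (hL _) (A.algebraMap_mem _)) _
  refine Algebra.eq_top_iff.2 fun f => ?_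
  have h : f = ∑ x, f x • (Pi.single x 1 : W → ℝ) := by
    simpa using (Pi.basisFun ℝ W).sum_repr f |>.symm
  rw [h]
  exact A.sum_mem fun x _ => A.smul_mem (hsingle x) _

theorem eq_zero_of_semilinear {D : Module.End ℝ (W → ℝ)} (w : W)
    (hD : ∀ y g, D (cs.orbitEval v y * g) = cs.orbitEval v (cs.geomRep w y) * D g)
    (h1 : D 1 = 0) : D = 0 := by
  refine LinearMap.ext fun f => ?_
  have hf : f ∈ Algebra.adjoin ℝ (Set.range (cs.orbitEval v)) := by
    rw [adjoin_range_orbitEval hv]; trivial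
  have key : ∀ g, D g = 0 → D (f * g) = 0 := by
    induction hf using Algebra.adjoin_induction with
    | mem _ h =>
      obtain ⟨y, rfl⟩ := h
      intro g hg
      rw [hD, hg, mul_zero]
    | algebraMap r =>
      intro g hg
      rw [← Algebra.smul_def, map_smul, hg, smul_zero]
    | add a b _ _ ha hb =>
      intro g hg
      rw [add_mul, map_add, ha g hg, hb g hg, add_zero]
    | mul a b _ _ ha hb =>
      intro g hg
      rw [mul_assoc]
      exact ha _ (hb g hg)
  simpa using key 1 h1

variable (cs v) in
omit hv in
/-- The divided difference operator of an element of `W`, obtained by composing the operators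
along a reduced word. -/
noncomputable def divDiffOp (w : W) : Module.End ℝ (W → ℝ) :=
  if h : w = 1 then 1
  else
    divDiffOp (w * cs.simple (cs.exists_rightDescent_of_ne_one h).choose) *
      cs.divDiff v (cs.exists_rightDescent_of_ne_one h).choose
termination_by cs.length w
decreasing_by exact (cs.exists_rightDescent_of_ne_one h).choose_spec

omit hv in
theorem divDiffOp_one : cs.divDiffOp v 1 = 1 := by
  rw [divDiffOp, dif_pos rfl]

omit hv in
theorem exists_divDiffOp_eq {w : W} (hw : w ≠ 1) : ∃ i, cs.IsRightDescent w i ∧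
    cs.divDiffOp v w = cs.divDiffOp v (w * cs.simple i) * cs.divDiff v i := by
  refine ⟨_, (cs.exists_rightDescent_of_ne_one hw).choose_spec, ?_⟩
  rw [divDiffOp, dif_neg hw]

omit hv in
theorem divDiffOp_apply_one {w : W} (hw : w ≠ 1) : cs.divDiffOp v w 1 = 0 := by
  obtain ⟨i, -, h⟩ := cs.exists_divDiffOp_eq (v := v) hw
  rw [h, Module.End.mul_apply, divDiff_one, map_zero]

variable (cs) in
omit hv in
/-- The correction term in the twisted Leibniz rule for `divDiffOp`. -/
noncomputable def leibnizTerm (v : (B → ℝ) →ₗ[ℝ] ℝ) (w : W) (y : B → ℝ) (g : W → ℝ) : W → ℝ :=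
  ∑ β ∈ cs.posRoots, if cs.length (w * cs.rootRefl β) + 1 = cs.length w then
    geomForm M y β • cs.divDiffOp v (w * cs.rootRefl β) g else 0

omit hv in
theorem leibnizTerm_mul_simple {w : W} {i : B} (hi : cs.IsRightDescent w i)
    (ih : ∀ x j, cs.length x < cs.length w → cs.IsRightDescent x j →
      cs.divDiffOp v x = cs.divDiffOp v (x * cs.simple j) * cs.divDiff v j)
    (y : B → ℝ) (g : W → ℝ) :
    cs.leibnizTerm v (w * cs.simple i) (cs.geomRep (cs.simple i) y) (cs.divDiff v i g) +
      geomForm M (simpleRoot i) y • cs.divDiffOp v (w * cs.simple i) g =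
      cs.leibnizTerm v w y g := by
  have hl := cs.isRightDescent_iff.1 hi
  have hi0 := cs.simpleRoot_mem_posRoots i
  have hs (β : B → ℝ) : cs.geomRep (cs.simple i) (cs.geomRep (cs.simple i) β) = β := by
    rw [← geomRep_mul_apply, simple_mul_simple_self, map_one, Module.End.one_apply]
  rw [leibnizTerm, leibnizTerm, ← Finset.add_sum_erase _ _ hi0, ← Finset.add_sum_erase _ _ hi0,
    rootRefl_simpleRoot, simple_mul_simple_cancel_right, if_neg (by omega), if_pos hl, zero_add,
    add_comm, geomForm_comm y]
  congr 1
  have hmem (β) (hβ : β ∈ cs.posRoots.erase (simpleRoot i)) :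
      cs.geomRep (cs.simple i) β ∈ cs.posRoots.erase (simpleRoot i) := by
    obtain ⟨hβi, hβ⟩ := Finset.mem_erase.1 hβ
    refine Finset.mem_erase.2 ⟨fun h => ?_, geomRep_simple_mem_posRoots hβ hβi⟩
    rw [← hs β, h, geomRep_simple_simpleRoot] at hβ
    exact not_nonpos_of_mem_posRoots hβ (neg_nonpos.2 (simpleRoot_nonneg i))
  refine Finset.sum_bij' (fun β _ => cs.geomRep (cs.simple i) β)
    (fun β _ => cs.geomRep (cs.simple i) β) hmem hmem (fun β _ => hs β) (fun β _ => hs β)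
    fun β hβ => ?_
  obtain ⟨hβi, hβ⟩ := Finset.mem_erase.1 hβ
  have hγ : w * cs.rootRefl (cs.geomRep (cs.simple i) β) =
      w * cs.simple i * cs.rootRefl β * cs.simple i := by
    rw [rootRefl_geomRep hβ, inv_simple]
    simp only [mul_assoc]
  have hγ' := length_mul_rootRefl_lt_iff (geomRep_simple_mem_posRoots hβ hβi) (w := w)
  rw [← geomRep_mul_apply, ← length_mul_rootRefl_lt_iff hβ, hγ] at hγ'
  have hB : geomForm M (cs.geomRep (cs.simple i) y) β =
      geomForm M y (cs.geomRep (cs.simple i) β) := by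
    rw [← cs.geomForm_geomRep (cs.simple i), hs]
  rw [hγ, hB]
  set z := w * cs.simple i * cs.rootRefl β
  have hz := cs.length_mul_simple z i
  split_ifs with h1 h2 h2
  · have hzi : cs.IsRightDescent (z * cs.simple i) i :=
      cs.isRightDescent_iff.2 (by rw [simple_mul_simple_cancel_right]; omega)
    rw [ih _ i (by omega) hzi, simple_mul_simple_cancel_right, Module.End.mul_apply]
  · rw [ih z i (by omega) (cs.isRightDescent_iff.2 (by omega)), Module.End.mul_apply,
      ← Module.End.mul_apply (cs.divDiff v i), divDiff_mul_self, LinearMap.zero_apply, map_zero,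
      smul_zero]
  · omega
  · rfl

theorem divDiffOp_eq_and_orbitEval_mul (w : W) :
    (∀ i, cs.IsRightDescent w i →
      cs.divDiffOp v w = cs.divDiffOp v (w * cs.simple i) * cs.divDiff v i) ∧
    ∀ y g, cs.divDiffOp v w (cs.orbitEval v y * g) =
      cs.orbitEval v (cs.geomRep w y) * cs.divDiffOp v w g + cs.leibnizTerm v w y g := by
  induction hn : cs.length w using Nat.strong_induction_on generalizing w with
  | _ n ih =>
    have key (i : B) (hi : cs.IsRightDescent w i) (y g) :
        (cs.divDiffOp v (w * cs.simple i) * cs.divDiff v i) (cs.orbitEval v y * g) =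
          cs.orbitEval v (cs.geomRep w y) *
            (cs.divDiffOp v (w * cs.simple i) * cs.divDiff v i) g + cs.leibnizTerm v w y g := by
      rw [Module.End.mul_apply, divDiff_orbitEval_mul hv, map_add, map_smul,
        (ih _ (hn ▸ hi) _ rfl).2, ← geomRep_mul_apply, simple_mul_simple_cancel_right, add_assoc,
        leibnizTerm_mul_simple hi fun x j hx hj => (ih _ (hn ▸ hx) x rfl).1 j hj,
        Module.End.mul_apply]
    rcases eq_or_ne w 1 with rfl | hw
    · refine ⟨fun i hi => absurd hi (cs.not_isRightDescent_one i), fun y g => ?_⟩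
      simp [divDiffOp_one, leibnizTerm]
    obtain ⟨j, hj, hwj⟩ := cs.exists_divDiffOp_eq (v := v) hw
    have h2 : ∀ y g, cs.divDiffOp v w (cs.orbitEval v y * g) =
        cs.orbitEval v (cs.geomRep w y) * cs.divDiffOp v w g + cs.leibnizTerm v w y g := by
      rw [hwj]
      exact key j hj
    refine ⟨fun i hi => ?_, h2⟩
    rw [← sub_eq_zero]
    refine eq_zero_of_semilinear hv w (fun y g => ?_) ?_
    · rw [LinearMap.sub_apply, LinearMap.sub_apply, h2, key i hi, mul_sub]
      abel
    · rw [LinearMap.sub_apply, divDiffOp_apply_one hw, Module.End.mul_apply, divDiff_one, map_zero,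
        sub_zero]

theorem divDiffOp_eq {w : W} {i : B} (hi : cs.IsRightDescent w i) :
    cs.divDiffOp v w = cs.divDiffOp v (w * cs.simple i) * cs.divDiff v i :=
  (divDiffOp_eq_and_orbitEval_mul hv w).1 i hi

theorem divDiffOp_mul_divDiff_of_isRightDescent {w : W} {i : B} (hi : cs.IsRightDescent w i) :
    cs.divDiffOp v w * cs.divDiff v i = 0 := by
  rw [divDiffOp_eq hv hi, mul_assoc, divDiff_mul_self, mul_zero]

theorem divDiffOp_mul_divDiff_of_not_isRightDescent {w : W} {i : B}
    (hi : ¬cs.IsRightDescent w i) :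
    cs.divDiffOp v w * cs.divDiff v i = cs.divDiffOp v (w * cs.simple i) := by
  rw [divDiffOp_eq hv (w := w * cs.simple i) (i := i), simple_mul_simple_cancel_right]
  rw [isRightDescent_iff_not_isRightDescent_mul, simple_mul_simple_cancel_right]
  exact hi

theorem divDiffOp_mul_divDiffOp (u w : W) : cs.divDiffOp v u * cs.divDiffOp v w = 0 ∨
    cs.divDiffOp v u * cs.divDiffOp v w = cs.divDiffOp v (u * w) ∧
      cs.length (u * w) = cs.length u + cs.length w := by
  induction hn : cs.length w using Nat.strong_induction_on generalizing w with
  | _ n ih =>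
    rcases eq_or_ne w 1 with rfl | hw
    · right
      rw [length_one] at hn
      simp [divDiffOp_one, ← hn]
    obtain ⟨i, hi⟩ := cs.exists_rightDescent_of_ne_one hw
    have hl := cs.isRightDescent_iff.1 hi
    rw [divDiffOp_eq hv hi, ← mul_assoc]
    rcases ih _ (by omega) (w * cs.simple i) rfl with h | ⟨h, h'⟩
    · left
      rw [h, zero_mul]
    rw [h]
    by_cases hui : cs.IsRightDescent (u * (w * cs.simple i)) i
    · exact .inl (divDiffOp_mul_divDiff_of_isRightDescent hv hui)
    · right
      have hl' := cs.not_isRightDescent_iff.1 hui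
      rw [divDiffOp_mul_divDiff_of_not_isRightDescent hv hui]
      rw [← mul_assoc, simple_mul_simple_cancel_right] at hl' ⊢
      rw [← mul_assoc] at h'
      exact ⟨rfl, by omega⟩

theorem eq_zero_of_divDiffOp_apply_eq_zero {f : W → ℝ} (hf : ∀ u, cs.divDiffOp v u f 1 = 0) :
    f = 0 := by
  ext x
  induction x using cs.simple_induction_left generalizing f with
  | one => simpa [divDiffOp_one] using hf 1
  | mul_simple_left x i ih =>
    have h1 : cs.divDiff v i f x = 0 := by
      refine ih fun u => ?_
      rw [← Module.End.mul_apply]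
      by_cases hi : cs.IsRightDescent u i
      · rw [divDiffOp_mul_divDiff_of_isRightDescent hv hi]
        rfl
      · rw [divDiffOp_mul_divDiff_of_not_isRightDescent hv hi, hf]
    rw [divDiff_apply, div_eq_zero_iff, or_iff_left (orbitEval_simpleRoot_ne_zero hv i x),
      sub_eq_zero] at h1
    rw [← h1, ih hf, Pi.zero_apply, Pi.zero_apply]

omit hv in
theorem divDiffOp_funLeft_mul_right {w₀ : W} (h2 : w₀ * w₀ = 1)
    (hv₀ : ∀ x, v (cs.geomRep w₀ x) = -v x) (w : W) (f : W → ℝ) :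
    cs.divDiffOp v w (LinearMap.funLeft ℝ ℝ (· * w₀) f) =
      (-1 : ℝ) ^ cs.length w • LinearMap.funLeft ℝ ℝ (· * w₀) (cs.divDiffOp v w f) := by
  have key (i : B) (f : W → ℝ) : cs.divDiff v i (LinearMap.funLeft ℝ ℝ (· * w₀) f) =
      -LinearMap.funLeft ℝ ℝ (· * w₀) (cs.divDiff v i f) := by
    ext x
    rw [Pi.neg_apply, LinearMap.funLeft_apply, divDiff_apply, divDiff_apply,
      LinearMap.funLeft_apply, LinearMap.funLeft_apply, orbitEval_apply, orbitEval_apply,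
      mul_inv_rev, inv_eq_of_mul_eq_one_left h2, geomRep_mul_apply, hv₀, div_neg, neg_neg,
      mul_assoc]
  induction hn : cs.length w using Nat.strong_induction_on generalizing w f with
  | _ n ih =>
    rcases eq_or_ne w 1 with rfl | hw
    · rw [length_one] at hn
      simp [divDiffOp_one, ← hn]
    obtain ⟨i, hi, h⟩ := cs.exists_divDiffOp_eq (v := v) hw
    have hl := cs.isRightDescent_iff.1 hi
    rw [h, Module.End.mul_apply, key, map_neg, ih _ (by omega) _ _ rfl, Module.End.mul_apply,
      ← hn, ← hl, pow_succ, mul_neg_one, neg_smul]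

theorem divDiffOp_funLeft_apply_one {w₀ : W} (h2 : w₀ * w₀ = 1)
    (hv₀ : ∀ x, v (cs.geomRep w₀ x) = -v x) {w : W} {f : W → ℝ}
    (hf : ∀ u, cs.length w < cs.length u → cs.divDiffOp v u f 1 = 0) :
    cs.divDiffOp v w (LinearMap.funLeft ℝ ℝ (· * w₀) f) 1 =
      (-1 : ℝ) ^ cs.length w * cs.divDiffOp v w f 1 := by
  set g := cs.divDiffOp v w f
  have hg : g - g 1 • 1 = 0 := by
    refine eq_zero_of_divDiffOp_apply_eq_zero hv fun u => ?_
    rw [map_sub, map_smul]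
    rcases eq_or_ne u 1 with rfl | hu
    · simp [divDiffOp_one]
    rw [divDiffOp_apply_one hu, smul_zero, sub_zero]
    change (cs.divDiffOp v u * cs.divDiffOp v w) f 1 = 0
    rcases divDiffOp_mul_divDiffOp hv u w with h | ⟨h, h'⟩
    · rw [h]
      rfl
    · rw [h]
      have := mt cs.length_eq_zero_iff.1 hu
      exact hf _ (by omega)
  have h0 : g w₀ = g 1 := by
    have := congrFun hg w₀
    simpa [sub_eq_zero] using this
  rw [divDiffOp_funLeft_mul_right h2 hv₀, Pi.smul_apply, LinearMap.funLeft_apply, one_mul,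
    smul_eq_mul]
  exact congrArg _ h0

end DivDiff

/-! ### Functions on the cosets of a parabolic subgroup -/

section Parabolic

variable (J : Finset B)

variable {cs J} in
theorem exists_isRightDescent_of_notMem_CoxX {w : W} (hw : w ∉ CoxX cs J) :
    ∃ j ∈ J, cs.IsRightDescent w j := by
  simp only [CoxX, Finset.mem_filter, Finset.mem_univ, true_and, not_forall, not_lt] at hw
  obtain ⟨j, hj, h⟩ := hw
  exact ⟨j, hj, lt_of_le_of_ne h (cs.length_mul_simple_ne w j)⟩

variable {cs J} in
theorem mul_simple_notMem_CoxX {w : W} {j : B} (hj : j ∈ J) (h : ¬cs.IsRightDescent w j) :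
    w * cs.simple j ∉ CoxX cs J := by
  intro hw
  have h1 := (Finset.mem_filter.1 hw).2 j hj
  rw [simple_mul_simple_cancel_right] at h1
  have := cs.not_isRightDescent_iff.1 h
  omega

theorem simple_mem_CoxParabolic {j : B} (hj : j ∈ J) : cs.simple j ∈ CoxParabolic cs J :=
  Subgroup.subset_closure ⟨j, hj, rfl⟩

/-- The pullback of functions on `W ⧸ W_J` to `W` along `x ↦ x⁻¹ W_J`. -/
noncomputable def cosetPullback : (W ⧸ CoxParabolic cs J → ℝ) →ₗ[ℝ] W → ℝ :=
  LinearMap.funLeft ℝ ℝ fun x => ((x⁻¹ : W) : W ⧸ CoxParabolic cs J)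

theorem cosetPullback_apply (g : W ⧸ CoxParabolic cs J → ℝ) (x : W) :
    cs.cosetPullback J g x = g ((x⁻¹ : W) : W ⧸ CoxParabolic cs J) := rfl

variable {v : (B → ℝ) →ₗ[ℝ] ℝ} (hv : ∀ β ∈ cs.posRoots, 0 < v β)
include hv

theorem divDiffOp_cosetPullback {w : W} (hw : w ∉ CoxX cs J) (g : W ⧸ CoxParabolic cs J → ℝ) :
    cs.divDiffOp v w (cs.cosetPullback J g) = 0 := by
  obtain ⟨j, hj, h⟩ := exists_isRightDescent_of_notMem_CoxX hw
  have h0 : cs.divDiff v j (cs.cosetPullback J g) = 0 := by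
    rw [divDiff_eq_zero_iff hv]
    intro x
    rw [cosetPullback_apply, cosetPullback_apply, mul_inv_rev, inv_simple,
      QuotientGroup.mk_mul_of_mem _ (cs.simple_mem_CoxParabolic J hj)]
  rw [divDiffOp_eq hv h, Module.End.mul_apply, h0, map_zero]

omit hv in
variable (v) in
/-- The coordinates of a function on `W ⧸ W_J` given by the divided differences at the identity
indexed by `X_J`. -/
noncomputable def cosetCoord : (W ⧸ CoxParabolic cs J → ℝ) →ₗ[ℝ] CoxX cs J → ℝ :=
  LinearMap.pi fun w => LinearMap.proj 1 ∘ₗ cs.divDiffOp v w ∘ₗ cs.cosetPullback J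

omit hv in
theorem cosetCoord_apply (g : W ⧸ CoxParabolic cs J → ℝ) (w : CoxX cs J) :
    cs.cosetCoord J v g w = cs.divDiffOp v w (cs.cosetPullback J g) 1 := rfl

theorem cosetCoord_injective : Function.Injective (cs.cosetCoord J v) := by
  rw [injective_iff_map_eq_zero]
  intro g hg
  have h : cs.cosetPullback J g = 0 := by
    refine eq_zero_of_divDiffOp_apply_eq_zero hv fun u => ?_
    by_cases hu : u ∈ CoxX cs J
    · exact congrFun hg ⟨u, hu⟩
    · rw [divDiffOp_cosetPullback cs J hv hu]
      rfl
  ext q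
  obtain ⟨x, rfl⟩ := QuotientGroup.mk_surjective q
  simpa [cosetPullback_apply] using congrFun h x⁻¹

theorem cosetCoord_surjective : Function.Surjective (cs.cosetCoord J v) := by
  intro h
  let Φ : (W → ℝ) →ₗ[ℝ] W → ℝ := LinearMap.pi fun w => LinearMap.proj 1 ∘ₗ cs.divDiffOp v w
  have hΦ : Function.Surjective Φ := by
    rw [← LinearMap.injective_iff_surjective, injective_iff_map_eq_zero]
    exact fun f hf => eq_zero_of_divDiffOp_apply_eq_zero hv fun u => congrFun hf u
  obtain ⟨f, hf⟩ := hΦ fun w => if hw : w ∈ CoxX cs J then h ⟨w, hw⟩ else 0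
  replace hf (w : W) : cs.divDiffOp v w f 1 = if hw : w ∈ CoxX cs J then h ⟨w, hw⟩ else 0 :=
    congrFun hf w
  have hinv (j) (hj : j ∈ J) (x : W) : f (cs.simple j * x) = f x := by
    refine (divDiff_eq_zero_iff hv j f).1 (eq_zero_of_divDiffOp_apply_eq_zero hv fun u => ?_) x
    rw [← Module.End.mul_apply]
    by_cases hu : cs.IsRightDescent u j
    · rw [divDiffOp_mul_divDiff_of_isRightDescent hv hu]
      rfl
    · rw [divDiffOp_mul_divDiff_of_not_isRightDescent hv hu, hf,
        dif_neg (mul_simple_notMem_CoxX hj hu)]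
  have hinv' (p) (hp : p ∈ CoxParabolic cs J) (x : W) : f (p * x) = f x := by
    induction hp using Subgroup.closure_induction generalizing x with
    | mem _ h =>
      obtain ⟨j, hj, rfl⟩ := h
      exact hinv j hj x
    | one => rw [one_mul]
    | mul a b _ _ ha hb => rw [mul_assoc, ha, hb]
    | inv a _ ha => rw [← ha, mul_inv_cancel_left]
  have hpull : cs.cosetPullback J (fun q => f q.out⁻¹) = f := by
    ext x
    obtain ⟨p, hp⟩ := QuotientGroup.mk_out_eq_mul (CoxParabolic cs J) x⁻¹
    rw [cosetPullback_apply, hp, mul_inv_rev, inv_inv]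
    exact hinv' _ (inv_mem p.2) x
  refine ⟨fun q => f q.out⁻¹, funext fun w => ?_⟩
  rw [cosetCoord_apply, hpull, hf, dif_pos w.2]

omit hv in
theorem trace_eq_sum_apply_single {ι : Type*} [Fintype ι] [DecidableEq ι]
    (T : (ι → ℝ) →ₗ[ℝ] ι → ℝ) :
    LinearMap.trace ℝ _ T = ∑ i, T (Pi.single i 1) i := by
  rw [LinearMap.trace_eq_matrix_trace ℝ (Pi.basisFun ℝ ι)]
  simp [Matrix.trace]

omit hv in
theorem mk_bijective_CoxX (hcard : (CoxX cs J).card = Nat.card (W ⧸ CoxParabolic cs J)) :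
    Function.Bijective fun w : CoxX cs J => ((w : W) : W ⧸ CoxParabolic cs J) := by
  rw [Fintype.bijective_iff_surjective_and_card]
  refine ⟨fun q => ?_, by simpa using hcard⟩
  obtain ⟨w, hw, hmin⟩ := Finset.exists_min_image
    (Finset.univ.filter fun w : W => (w : W ⧸ CoxParabolic cs J) = q) cs.length
    ⟨q.out, by simp⟩
  simp only [Finset.mem_filter, Finset.mem_univ, true_and] at hw hmin
  refine ⟨⟨w, Finset.mem_filter.2 ⟨Finset.mem_univ w, fun j hj => ?_⟩⟩, hw⟩
  refine lt_of_le_of_ne (hmin _ ?_) (cs.length_mul_simple_ne w j).symm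
  rw [QuotientGroup.mk_mul_of_mem _ (cs.simple_mem_CoxParabolic J hj), hw]

omit hv in
theorem cosetPullback_funLeft_smul {w₀ : W} (h2 : w₀ * w₀ = 1)
    (g : W ⧸ CoxParabolic cs J → ℝ) :
    cs.cosetPullback J (LinearMap.funLeft ℝ ℝ (w₀ • ·) g) =
      LinearMap.funLeft ℝ ℝ (· * w₀) (cs.cosetPullback J g) := by
  ext x
  rw [cosetPullback_apply, LinearMap.funLeft_apply, LinearMap.funLeft_apply, cosetPullback_apply,
    mul_inv_rev, inv_eq_of_mul_eq_one_left h2]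
  rfl

theorem card_CoxX_eq : (CoxX cs J).card = Nat.card (W ⧸ CoxParabolic cs J) := by
  have := (LinearEquiv.ofBijective (cs.cosetCoord J v)
    ⟨cs.cosetCoord_injective J hv, cs.cosetCoord_surjective J hv⟩).finrank_eq
  simpa using this.symm

theorem sum_neg_one_pow_length_eq {w₀ : W} (h2 : w₀ * w₀ = 1)
    (hv₀ : ∀ x, v (cs.geomRep w₀ x) = -v x) :
    ∑ w : CoxX cs J, (-1 : ℝ) ^ cs.length w =
      ∑ q : W ⧸ CoxParabolic cs J, if w₀ • q = q then 1 else 0 := by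
  let e := LinearEquiv.ofBijective (cs.cosetCoord J v)
    ⟨cs.cosetCoord_injective J hv, cs.cosetCoord_surjective J hv⟩
  let T : (W ⧸ CoxParabolic cs J → ℝ) →ₗ[ℝ] W ⧸ CoxParabolic cs J → ℝ :=
    LinearMap.funLeft ℝ ℝ (w₀ • ·)
  have htr := LinearMap.trace_conj' T e
  rw [trace_eq_sum_apply_single, trace_eq_sum_apply_single] at htr
  convert htr using 2 with w _ q _
  · rw [LinearEquiv.conj_apply_apply]
    set g := e.symm (Pi.single w 1)
    have hg (u : CoxX cs J) : cs.divDiffOp v u (cs.cosetPullback J g) 1 =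
        (Pi.single w 1 : CoxX cs J → ℝ) u :=
      congrFun (e.apply_symm_apply (Pi.single w 1)) u
    have h0 (u : W) (hu : cs.length w < cs.length u) :
        cs.divDiffOp v u (cs.cosetPullback J g) 1 = 0 := by
      by_cases huX : u ∈ CoxX cs J
      · rw [hg ⟨u, huX⟩, Pi.single_eq_of_ne]
        rintro rfl
        exact lt_irrefl _ hu
      · rw [divDiffOp_cosetPullback cs J hv huX]
        rfl
    change _ = cs.divDiffOp v w (cs.cosetPullback J (T g)) 1
    rw [cosetPullback_funLeft_smul cs J h2, divDiffOp_funLeft_apply_one hv h2 hv₀ h0, hg,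
      Pi.single_eq_same, mul_one]
  · rw [LinearMap.funLeft_apply]
    split_ifs with h
    · rw [h, Pi.single_eq_same]
    · rw [Pi.single_eq_of_ne h]

end Parabolic

end CoxeterSystem

/-- **Eng's theorem.** For a finite Coxeter system `(W,S)` with longest element `w₀`
and any `J ⊆ S`, the sum `Σ_{w ∈ X_J} (-1)^{l(w)}` equals the number of `w ∈ X_J`
with `w₀ • w • W_J = w • W_J`. -/
theorem eng_minus_one_phenomenon (cs : CoxeterSystem M W) (w₀ : W)
    (hw₀ : ∀ w : W, cs.length w ≤ cs.length w₀) (J : Finset B) :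
    ∑ w ∈ CoxX cs J, (-1 : ℤ) ^ cs.length w =
      (((CoxX cs J).filter fun w =>
        (w₀ * w) • (CoxParabolic cs J : Set W) = w • (CoxParabolic cs J : Set W)).card : ℤ) := by
  obtain ⟨v, hv, hv₀⟩ := CoxeterSystem.exists_regular_functional hw₀
  have hsum := cs.sum_neg_one_pow_length_eq J hv (CoxeterSystem.longest_mul_self hw₀) hv₀
  rw [← (cs.mk_bijective_CoxX J (cs.card_CoxX_eq J hv)).sum_comp] at hsum
  rw [← Finset.sum_coe_sort, Finset.card_filter, ← Finset.sum_coe_sort (CoxX cs J)]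
  have hiff (w : W) : (w₀ * w) • (CoxParabolic cs J : Set W) = w • (CoxParabolic cs J : Set W) ↔
      w₀ • (w : W ⧸ CoxParabolic cs J) = w := by
    rw [leftCoset_eq_iff, ← QuotientGroup.eq]
    rfl
  simp only [hiff]
  exact_mod_cast hsum
end

section
/- Let (W,S) be a finite Coxeter system and let I, J ⊆ S be W-conjugate, i.e., there exists w ∈ W with I = wJw⁻¹ (as subsets of W). Then D_I = D_J, where D_K = Σ_{w ∈ X_K} (-1)^{l(w)} for K ⊆ S. -/
open scoped Classical Pointwise

variable {B : Type*} [Fintype B]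
variable {W : Type*} [Group W] [Fintype W]
variable {M : CoxeterMatrix B}

namespace CoxeterSystem

variable {B W : Type*} [Group W] {M : CoxeterMatrix B}

/-- The action of a simple reflection on `W × ZMod 2` which conjugates the first coordinate and
records in the second coordinate whether that coordinate is the simple reflection itself. -/
noncomputable def signedConj (cs : CoxeterSystem M W) (i : B) : Function.End (W × ZMod 2) :=
  fun p => (cs.simple i * p.1 * cs.simple i, p.2 + if p.1 = cs.simple i then 1 else 0)

theorem signedConj_mul_pow_apply (cs : CoxeterSystem M W) (i i' : B) (k : ℕ) (t : W)
    (z : ZMod 2) :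
    ((cs.signedConj i * cs.signedConj i') ^ k) (t, z) =
      ((cs.simple i * cs.simple i') ^ k * t * ((cs.simple i * cs.simple i') ^ k)⁻¹,
        z + ∑ n ∈ Finset.range (2 * k),
          if t = cs.simple i' * (cs.simple i * cs.simple i') ^ n then 1 else 0) := by
  set c := cs.simple i * cs.simple i' with hc
  have hconj : ∀ k : ℕ, cs.simple i' * c ^ k = (c ^ k)⁻¹ * cs.simple i' := by
    intro k
    have h : SemiconjBy (cs.simple i') c c⁻¹ := by
      simp [SemiconjBy, hc, mul_assoc]
    simpa using (h.pow_right k).eq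
  induction k with
  | zero => simp; rfl
  | succ k ih =>
    have h₁ : c ^ k * t * (c ^ k)⁻¹ = cs.simple i' ↔ t = cs.simple i' * c ^ (2 * k) := by
      rw [two_mul, pow_add, ← mul_assoc, hconj, mul_inv_eq_iff_eq_mul, mul_assoc,
        eq_inv_mul_iff_mul_eq]
    have h₂ : cs.simple i' * (c ^ k * t * (c ^ k)⁻¹) * cs.simple i' = cs.simple i ↔
        t = cs.simple i' * c ^ (2 * k + 1) := by
      have h₃ : cs.simple i' * c ^ (2 * k + 1) =
          (c ^ k)⁻¹ * (cs.simple i' * cs.simple i * cs.simple i') * c ^ k := by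
        rw [show 2 * k + 1 = k + (1 + k) by ring, pow_add, ← mul_assoc, hconj, pow_add, hc]
        simp [mul_assoc]
      rw [h₃]
      constructor
      · intro h
        rw [← h]
        simp [mul_assoc]
      · intro h
        rw [h]
        simp [mul_assoc]
    rw [pow_succ']
    change (cs.signedConj i) (cs.signedConj i' (((cs.signedConj i * cs.signedConj i') ^ k) (t, z)))
      = _
    rw [ih, show 2 * (k + 1) = 2 * k + 1 + 1 by ring, Finset.sum_range_succ,
      Finset.sum_range_succ]
    simp only [signedConj, h₁, h₂, Prod.mk.injEq]
    refine ⟨?_, by ring⟩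
    rw [pow_succ', hc]
    simp [mul_assoc]

theorem isLiftable_signedConj (cs : CoxeterSystem M W) : M.IsLiftable cs.signedConj := by
  intro i i'
  funext ⟨t, z⟩
  rw [signedConj_mul_pow_apply, two_mul, Finset.sum_range_add]
  simp only [pow_add, cs.simple_mul_simple_pow, one_mul, CharTwo.add_self_eq_zero]
  simp
  rfl

theorem lift_signedConj_wordProd (cs : CoxeterSystem M W) (ω : List B) (t : W) (z : ZMod 2) :
    cs.lift ⟨_, cs.isLiftable_signedConj⟩ (cs.wordProd ω) (t, z) =
      (cs.wordProd ω * t * (cs.wordProd ω)⁻¹, z + (cs.rightInvSeq ω).count t) := by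
  induction ω with
  | nil => simp; rfl
  | cons i ω ih =>
    rw [wordProd_cons, map_mul]
    change cs.lift ⟨_, cs.isLiftable_signedConj⟩ (cs.simple i)
      (cs.lift ⟨_, cs.isLiftable_signedConj⟩ (cs.wordProd ω) (t, z)) = _
    rw [ih, lift_apply_simple]
    have h : cs.wordProd ω * t * (cs.wordProd ω)⁻¹ = cs.simple i ↔
        (cs.wordProd ω)⁻¹ * cs.simple i * cs.wordProd ω = t := by
      constructor <;> rintro h <;> rw [← h] <;> simp [mul_assoc]
    simp only [signedConj, rightInvSeq, List.count_cons, h, beq_iff_eq, Prod.mk.injEq]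
    refine ⟨by simp [mul_assoc], ?_⟩
    push_cast
    ring

/-- The parity of the number of occurrences of `t` in the right inversion sequence of any word
representing `w`. -/
noncomputable def inversionParity (cs : CoxeterSystem M W) (w t : W) : ZMod 2 :=
  (cs.lift ⟨_, cs.isLiftable_signedConj⟩ w (t, 0)).2

theorem inversionParity_wordProd (cs : CoxeterSystem M W) (ω : List B) (t : W) :
    cs.inversionParity (cs.wordProd ω) t = (cs.rightInvSeq ω).count t := by
  rw [inversionParity, lift_signedConj_wordProd, zero_add]

theorem inversionParity_mul (cs : CoxeterSystem M W) (v w t : W) :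
    cs.inversionParity (v * w) t =
      cs.inversionParity w t + cs.inversionParity v (w * t * w⁻¹) := by
  obtain ⟨α, rfl⟩ := cs.wordProd_surjective v
  obtain ⟨β, rfl⟩ := cs.wordProd_surjective w
  rw [inversionParity_wordProd, inversionParity_wordProd, inversionParity, map_mul]
  change (cs.lift ⟨_, cs.isLiftable_signedConj⟩ (cs.wordProd α)
      (cs.lift ⟨_, cs.isLiftable_signedConj⟩ (cs.wordProd β) (t, 0))).2 = _
  rw [lift_signedConj_wordProd, lift_signedConj_wordProd, zero_add]

theorem inversionParity_one (cs : CoxeterSystem M W) (t : W) : cs.inversionParity 1 t = 0 := by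
  simpa using cs.inversionParity_wordProd [] t

theorem inversionParity_simple_self (cs : CoxeterSystem M W) (i : B) :
    cs.inversionParity (cs.simple i) (cs.simple i) = 1 := by
  simpa using cs.inversionParity_wordProd [i] (cs.simple i)

theorem IsReflection.inversionParity_self {cs : CoxeterSystem M W} {t : W}
    (ht : cs.IsReflection t) : cs.inversionParity t t = 1 := by
  obtain ⟨u, i, rfl⟩ := ht
  have h := cs.inversionParity_mul u u⁻¹ (u * cs.simple i * u⁻¹)
  rw [mul_inv_cancel, inversionParity_one] at h
  rw [inversionParity_mul, inversionParity_mul]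
  have e : u⁻¹ * (u * cs.simple i * u⁻¹) * u⁻¹⁻¹ = cs.simple i := by simp [mul_assoc]
  rw [e] at h ⊢
  rw [show cs.simple i * cs.simple i * (cs.simple i)⁻¹ = cs.simple i by simp,
    inversionParity_simple_self, add_left_comm, ← h, add_zero]

theorem IsReflection.inversionParity_mul_self {cs : CoxeterSystem M W} {t : W}
    (ht : cs.IsReflection t) (w : W) :
    cs.inversionParity (w * t) t = cs.inversionParity w t + 1 := by
  rw [inversionParity_mul, ht.inversionParity_self, mul_inv_cancel_right, add_comm]

theorem length_mul_lt_of_inversionParity_eq_one (cs : CoxeterSystem M W) {w t : W}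
    (h : cs.inversionParity w t = 1) : cs.length (w * t) < cs.length w := by
  obtain ⟨ω, hω, rfl⟩ := cs.exists_isReduced w
  rw [inversionParity_wordProd] at h
  refine (cs.isRightInversion_of_mem_rightInvSeq hω (List.count_pos_iff.1 ?_)).2
  by_contra h₀
  simp [Nat.eq_zero_of_not_pos h₀] at h

theorem inversionParity_eq_zero_of_length_le (cs : CoxeterSystem M W) {w t : W}
    (h : cs.length w ≤ cs.length (w * t)) :
    cs.inversionParity w t = 0 := by
  by_contra h₀
  exact h.not_gt (cs.length_mul_lt_of_inversionParity_eq_one (Fin.eq_one_of_ne_zero _ h₀))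

end CoxeterSystem

section

variable {B W : Type*} [Group W] {M : CoxeterMatrix B}

/-- The words in the alphabet `J` representing `u`. -/
def CoxWords (cs : CoxeterSystem M W) (J : Finset B) (u : W) : Set (List B) :=
  {ω | (∀ i ∈ ω, i ∈ J) ∧ cs.wordProd ω = u}

/-- The least length of a word in the alphabet `J` representing `u`. -/
noncomputable def relLength (cs : CoxeterSystem M W) (J : Finset B) (u : W) : ℕ :=
  sInf (List.length '' CoxWords cs J u)

theorem mem_coxParabolic_iff (cs : CoxeterSystem M W) (J : Finset B) (u : W) :
    u ∈ CoxParabolic cs J ↔ (CoxWords cs J u).Nonempty := by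
  constructor
  · intro hu
    induction hu using Subgroup.closure_induction with
    | mem x hx =>
      obtain ⟨j, hj, rfl⟩ := hx
      exact ⟨[j], by simpa using hj, by simp⟩
    | one => exact ⟨[], by simp, by simp⟩
    | mul x y _ _ hx hy =>
      obtain ⟨α, hα, rfl⟩ := hx
      obtain ⟨β, hβ, rfl⟩ := hy
      refine ⟨α ++ β, fun i hi => ?_, cs.wordProd_append α β⟩
      exact (List.mem_append.1 hi).elim (hα i) (hβ i)
    | inv x _ hx =>
      obtain ⟨α, hα, rfl⟩ := hx
      exact ⟨α.reverse, fun i hi => hα i (List.mem_reverse.1 hi), cs.wordProd_reverse α⟩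
  · rintro ⟨ω, hω, rfl⟩
    refine Subgroup.list_prod_mem _ fun x hx => ?_
    obtain ⟨i, hi, rfl⟩ := List.mem_map.1 hx
    exact Subgroup.subset_closure ⟨i, hω i hi, rfl⟩

theorem relLength_le (cs : CoxeterSystem M W) {J : Finset B} {u : W} {ω : List B}
    (hω : ω ∈ CoxWords cs J u) : relLength cs J u ≤ ω.length :=
  Nat.sInf_le ⟨ω, hω, rfl⟩

theorem exists_length_eq_relLength (cs : CoxeterSystem M W) {J : Finset B} {u : W}
    (hu : u ∈ CoxParabolic cs J) : ∃ ω ∈ CoxWords cs J u, ω.length = relLength cs J u :=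
  Nat.sInf_mem (((mem_coxParabolic_iff cs J u).1 hu).image _)

theorem length_le_relLength (cs : CoxeterSystem M W) {J : Finset B} {u : W}
    (hu : u ∈ CoxParabolic cs J) : cs.length u ≤ relLength cs J u := by
  obtain ⟨ω, ⟨-, rfl⟩, h⟩ := exists_length_eq_relLength cs hu
  exact h ▸ cs.length_wordProd_le ω

/-- A nontrivial element of `W_J` has a right descent `j ∈ J`, expressed by inversion parity. -/
theorem exists_inversionParity_eq_one (cs : CoxeterSystem M W) {J : Finset B} {u : W}
    (hu : u ∈ CoxParabolic cs J) (hne : u ≠ 1) :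
    ∃ j ∈ J, cs.inversionParity u (cs.simple j) = 1 := by
  obtain ⟨ω, ⟨hJ, rfl⟩, hlen⟩ := exists_length_eq_relLength cs hu
  rcases List.eq_nil_or_concat ω with rfl | ⟨α, j, rfl⟩
  · simp at hne
  refine ⟨j, hJ j (by simp), ?_⟩
  by_contra hpar
  rw [CoxeterSystem.wordProd_concat, (cs.isReflection_simple j).inversionParity_mul_self,
    CoxeterSystem.inversionParity_wordProd] at hpar
  have hmem : cs.simple j ∈ cs.rightInvSeq α := by
    by_contra hn
    simp [List.count_eq_zero_of_not_mem hn] at hpar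
  obtain ⟨n, hn, hget⟩ := List.mem_iff_getElem.1 hmem
  have hdel : cs.wordProd (α.eraseIdx n) = cs.wordProd (α.concat j) := by
    rw [← cs.wordProd_mul_getD_rightInvSeq α n, List.getD_eq_getElem _ _ hn, hget,
      cs.wordProd_concat]
  have hle := relLength_le cs (J := J) (u := cs.wordProd (α.concat j)) (ω := α.eraseIdx n)
    ⟨fun i hi => hJ i (by simp [List.mem_of_mem_eraseIdx hi]), hdel⟩
  have := List.length_eraseIdx_le α n
  simp only [← hlen, List.length_concat] at hle
  omega

theorem exists_coxWords_conj (cs : CoxeterSystem M W) {I J : Finset B} {w : W}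
    (h : ∀ j ∈ J, ∃ i ∈ I, cs.simple i = w * cs.simple j * w⁻¹) {u : W} {ω : List B}
    (hω : ω ∈ CoxWords cs J u) : ∃ α ∈ CoxWords cs I (w * u * w⁻¹), α.length = ω.length := by
  obtain ⟨hω, rfl⟩ := hω
  induction ω with
  | nil => exact ⟨[], ⟨by simp, by simp⟩, rfl⟩
  | cons j ω ih =>
    obtain ⟨α, ⟨hα, he⟩, hl⟩ := ih fun i hi => hω i (List.mem_cons_of_mem j hi)
    obtain ⟨i, hi, hs⟩ := h j (hω j List.mem_cons_self)
    refine ⟨i :: α, ⟨?_, ?_⟩, by simp [hl]⟩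
    · rintro k hk
      rcases List.mem_cons.1 hk with rfl | hk
      exacts [hi, hα k hk]
    · rw [cs.wordProd_cons, cs.wordProd_cons, he, hs]
      simp [mul_assoc]

theorem conj_mem_coxParabolic (cs : CoxeterSystem M W) {I J : Finset B} {w : W}
    (h : ∀ j ∈ J, ∃ i ∈ I, cs.simple i = w * cs.simple j * w⁻¹) {u : W}
    (hu : u ∈ CoxParabolic cs J) : w * u * w⁻¹ ∈ CoxParabolic cs I := by
  obtain ⟨ω, hω⟩ := (mem_coxParabolic_iff cs J u).1 hu
  obtain ⟨α, hα, -⟩ := exists_coxWords_conj cs h hω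
  exact (mem_coxParabolic_iff cs I _).2 ⟨α, hα⟩

theorem relLength_conj_le (cs : CoxeterSystem M W) {I J : Finset B} {w : W}
    (h : ∀ j ∈ J, ∃ i ∈ I, cs.simple i = w * cs.simple j * w⁻¹) {u : W}
    (hu : u ∈ CoxParabolic cs J) : relLength cs I (w * u * w⁻¹) ≤ relLength cs J u := by
  obtain ⟨ω, hω, hl⟩ := exists_length_eq_relLength cs hu
  obtain ⟨α, hα, hl'⟩ := exists_coxWords_conj cs h hω
  exact (relLength_le cs hα).trans_eq (hl'.trans hl)

end

section

variable {B W : Type*} [Group W] [Fintype W] {M : CoxeterMatrix B}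

open Polynomial in
theorem sum_coxParabolic_eq_of_conj (cs : CoxeterSystem M W) {I J : Finset B} {w : W}
    (h : ∀ j ∈ J, ∃ i ∈ I, cs.simple i = w * cs.simple j * w⁻¹)
    (h' : ∀ i ∈ I, ∃ j ∈ J, cs.simple j = w⁻¹ * cs.simple i * w⁻¹⁻¹) :
    ∑ u : CoxParabolic cs J, (X : ℤ[X]) ^ relLength cs J u =
      ∑ u : CoxParabolic cs I, X ^ relLength cs I u := by
  refine Finset.sum_bij' (fun u _ => ⟨w * u * w⁻¹, conj_mem_coxParabolic cs h u.2⟩)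
    (fun u _ => ⟨w⁻¹ * u * w⁻¹⁻¹, conj_mem_coxParabolic cs h' u.2⟩)
    (fun _ _ => Finset.mem_univ _) (fun _ _ => Finset.mem_univ _)
    (fun u _ => by simp [mul_assoc]) (fun u _ => by simp [mul_assoc]) fun u _ => ?_
  have h₁ := relLength_conj_le cs h u.2
  have h₂ := relLength_conj_le cs h' (conj_mem_coxParabolic cs h u.2)
  rw [show w⁻¹ * (w * (u : W) * w⁻¹) * w⁻¹⁻¹ = u by simp [mul_assoc]] at h₂
  rw [le_antisymm h₁ h₂]

open Polynomial in
theorem sum_coxParabolic_ne_zero (cs : CoxeterSystem M W) (J : Finset B) :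
    ∑ u : CoxParabolic cs J, (X : ℤ[X]) ^ relLength cs J u ≠ 0 := by
  intro h
  simpa [eval_finsetSum] using congrArg (eval 1) h

end

theorem mem_coxX_iff (cs : CoxeterSystem M W) (J : Finset B) (w : W) :
    w ∈ CoxX cs J ↔ ∀ j ∈ J, cs.length w < cs.length (w * cs.simple j) := by
  simp [CoxX]

theorem eq_one_of_mul_mem_coxX (cs : CoxeterSystem M W) {J : Finset B} {y u : W}
    (hy : ∀ v ∈ CoxParabolic cs J, cs.length y ≤ cs.length (y * v))
    (hu : u ∈ CoxParabolic cs J) (hyu : y * u ∈ CoxX cs J) : u = 1 := by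
  by_contra hne
  obtain ⟨j, hj, hpar⟩ := exists_inversionParity_eq_one cs hu hne
  have hsj : cs.simple j ∈ CoxParabolic cs J := Subgroup.subset_closure ⟨j, hj, rfl⟩
  have h₀ : cs.inversionParity y (u * cs.simple j * u⁻¹) = 0 :=
    cs.inversionParity_eq_zero_of_length_le
      (hy _ (mul_mem (mul_mem hu hsj) (inv_mem hu)))
  have h₁ : cs.inversionParity (y * u) (cs.simple j) = 1 := by
    rw [cs.inversionParity_mul, hpar, h₀, add_zero]
  exact (cs.length_mul_lt_of_inversionParity_eq_one h₁).not_gt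
    ((mem_coxX_iff cs J _).1 hyu j hj)

theorem eq_of_mem_coxX (cs : CoxeterSystem M W) {J : Finset B} {x y : W}
    (hx : x ∈ CoxX cs J) (hy : y ∈ CoxX cs J) (hxy : x⁻¹ * y ∈ CoxParabolic cs J) : x = y := by
  obtain ⟨v, hv, hmin⟩ := Set.exists_min_image (CoxParabolic cs J : Set W)
    (fun v => cs.length (x * v)) (Set.toFinite _) ⟨1, one_mem _⟩
  have hmin' : ∀ u ∈ CoxParabolic cs J, cs.length (x * v) ≤ cs.length (x * v * u) :=
    fun u hu => mul_assoc x v u ▸ hmin _ (mul_mem hv hu)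
  have h₁ := eq_one_of_mul_mem_coxX cs hmin' (inv_mem hv) (by simpa using hx)
  rw [inv_eq_one] at h₁
  subst h₁
  have h₂ := eq_one_of_mul_mem_coxX cs hmin' hxy (by simpa using hy)
  exact inv_mul_eq_one.1 h₂

theorem exists_coxX_mul (cs : CoxeterSystem M W) (J : Finset B) (w : W) :
    ∃ x ∈ CoxX cs J, ∃ u ∈ CoxParabolic cs J,
      x * u = w ∧ cs.length w = cs.length x + relLength cs J u := by
  suffices h : ∀ n, ∀ w : W, cs.length w = n → ∃ x ∈ CoxX cs J, ∃ ω : List B,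
      (∀ i ∈ ω, i ∈ J) ∧ x * cs.wordProd ω = w ∧ cs.length w = cs.length x + ω.length by
    obtain ⟨x, hx, ω, hω, rfl, hl⟩ := h _ w rfl
    have hu := (mem_coxParabolic_iff cs J _).2 ⟨ω, hω, rfl⟩
    refine ⟨x, hx, _, hu, rfl, ?_⟩
    have h₁ := relLength_le cs (J := J) (ω := ω) ⟨hω, rfl⟩
    have h₂ := length_le_relLength cs hu
    have h₃ := cs.length_mul_le x (cs.wordProd ω)
    omega
  intro n
  induction n with
  | zero =>
    intro w hw
    rw [cs.length_eq_zero_iff] at hw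
    subst hw
    exact ⟨1, by simp [mem_coxX_iff], [], by simp, by simp, by simp⟩
  | succ n ih =>
    intro w hw
    by_cases hX : w ∈ CoxX cs J
    · exact ⟨w, hX, [], by simp, by simp, by simp⟩
    rw [mem_coxX_iff] at hX
    push Not at hX
    obtain ⟨j, hj, hle⟩ := hX
    have hlen := cs.length_mul_simple w j
    obtain ⟨x, hx, ω, hω, he, hl⟩ := ih (w * cs.simple j) (by omega)
    refine ⟨x, hx, ω.concat j, ?_, ?_, ?_⟩
    · intro i hi
      rw [List.concat_eq_append, List.mem_append, List.mem_singleton] at hi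
      rcases hi with hi | rfl
      exacts [hω i hi, hj]
    · rw [cs.wordProd_concat, ← mul_assoc, he, cs.simple_mul_simple_cancel_right]
    · rw [List.length_concat]
      omega

theorem length_mul_of_mem_coxX (cs : CoxeterSystem M W) {J : Finset B} {x u : W}
    (hx : x ∈ CoxX cs J) (hu : u ∈ CoxParabolic cs J) :
    cs.length (x * u) = cs.length x + relLength cs J u := by
  obtain ⟨y, hy, v, hv, h, hl⟩ := exists_coxX_mul cs J (x * u)
  have hxy : x⁻¹ * y = u * v⁻¹ := by
    rw [inv_mul_eq_iff_eq_mul, ← mul_assoc, ← h, mul_inv_cancel_right]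
  obtain rfl := eq_of_mem_coxX cs hx hy (hxy ▸ mul_mem hu (inv_mem hv))
  rw [hl, mul_left_cancel h]

open Polynomial in
theorem sum_coxX_mul_sum_coxParabolic (cs : CoxeterSystem M W) (J : Finset B) :
    (∑ x ∈ CoxX cs J, (X : ℤ[X]) ^ cs.length x) *
      (∑ u : CoxParabolic cs J, X ^ relLength cs J u) = ∑ w : W, X ^ cs.length w := by
  rw [Finset.sum_mul_sum, ← Finset.sum_product']
  refine Finset.sum_bij (fun p _ => p.1 * p.2) (fun _ _ => Finset.mem_univ _) ?_ ?_ ?_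
  · rintro ⟨x, u⟩ hp ⟨y, v⟩ hq h
    have hx := (Finset.mem_product.1 hp).1
    have hy := (Finset.mem_product.1 hq).1
    dsimp only at hx hy h
    have hxy : x⁻¹ * y = u * (v : W)⁻¹ := by
      rw [inv_mul_eq_iff_eq_mul, ← mul_assoc, h, mul_inv_cancel_right]
    obtain rfl := eq_of_mem_coxX cs hx hy (hxy ▸ mul_mem u.2 (inv_mem v.2))
    rw [Subtype.ext (mul_left_cancel h)]
  · intro w _
    obtain ⟨x, hx, u, hu, h, -⟩ := exists_coxX_mul cs J w
    exact ⟨(x, ⟨u, hu⟩), by simp [hx], h⟩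
  · rintro ⟨x, u⟩ hp
    rw [length_mul_of_mem_coxX cs (Finset.mem_product.1 hp).1 u.2, pow_add]

/-- If `I, J ⊆ S` are `W`-conjugate (i.e. `I = w J w⁻¹` as subsets of `W` for some `w`),
then `D_I = D_J`. -/
theorem coxD_eq_of_conjugate (cs : CoxeterSystem M W) (I J : Finset B)
    (h : ∃ w : W, (cs.simple '' ↑I : Set W) = (fun x => w * x * w⁻¹) '' (cs.simple '' ↑J)) :
    CoxD cs I = CoxD cs J := by
  obtain ⟨w, h⟩ := h
  have h₁ : ∀ j ∈ J, ∃ i ∈ I, cs.simple i = w * cs.simple j * w⁻¹ := fun j hj =>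
    (h.symm ▸ ⟨_, ⟨j, hj, rfl⟩, rfl⟩ : w * cs.simple j * w⁻¹ ∈ cs.simple '' (I : Set B))
  have h₂ : ∀ i ∈ I, ∃ j ∈ J, cs.simple j = w⁻¹ * cs.simple i * w⁻¹⁻¹ := by
    intro i hi
    obtain ⟨-, ⟨j, hj, rfl⟩, he⟩ :=
      (h ▸ ⟨i, hi, rfl⟩ : cs.simple i ∈ (fun x => w * x * w⁻¹) '' (cs.simple '' (J : Set B)))
    exact ⟨j, hj, by simp [← he, mul_assoc]⟩
  have hpoly := (sum_coxX_mul_sum_coxParabolic cs I).trans (sum_coxX_mul_sum_coxParabolic cs J).symm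
  rw [sum_coxParabolic_eq_of_conj cs h₁ h₂] at hpoly
  simpa [Polynomial.eval_finsetSum, CoxD] using congrArg (Polynomial.eval (-1))
    (mul_right_cancel₀ (sum_coxParabolic_ne_zero cs I) hpoly)
end

section
/- Let (W,S) be a finite Coxeter system and let I, J ⊆ S. Then Σ_{u ∈ X_I} |{w ∈ X_J : u·w·W_J = w·W_J}| = Σ_{u ∈ X_J} |{w ∈ X_I : u·w·W_I = w·W_I}|. (This is the symmetry property Φ(x_I)(x_J) = Φ(x_J)(x_I) of Solomon's homomorphism on the descent algebra, stated combinatorially on the basis elements x_I, x_J via the permutation characters Ind_{W_K}^W 1.) -/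
open scoped Classical Pointwise

variable {B : Type*} [Fintype B]
variable {W : Type*} [Group W] [Fintype W]
variable {M : CoxeterMatrix B}

/-- An abstract record of the sides of the walls of a chamber system on which `G` acts simply
transitively: chambers are elements of `G`, walls are indexed by elements of `G`, and `side w t`
says on which side of the wall of `t` the chamber `w` lies. -/
structure WallSides (G : Type*) [Group G] where
  side : G → G → ZMod 2
  rank : G → ℕ
  side_mul : ∀ x y t, side (x * y) t = side x t + side y (x⁻¹ * t * x)
  eq_one : ∀ w, (∀ t, side w t = 0) → w = 1
  rank_lt : ∀ w t, side w t ≠ 0 → rank (t * w) < rank w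

namespace CoxeterSystem

section SignedReflections

variable {B' : Type*} {W' : Type*} [Group W'] {M' : CoxeterMatrix B'} (cs : CoxeterSystem M' W')

/-- The action of a simple reflection on signed group elements, flipping the sign exactly at the
reflection itself. -/
noncomputable def signedStep (i : B') : Function.End (W' × ZMod 2) :=
  fun p => (cs.simple i * p.1 * cs.simple i, p.2 + if p.1 = cs.simple i then 1 else 0)

theorem prod_map_signedStep (ω : List B') (t : W') (ε : ZMod 2) :
    (ω.map cs.signedStep).prod (t, ε) =
      (cs.wordProd ω * t * (cs.wordProd ω)⁻¹, ε + ((cs.rightInvSeq ω).count t : ZMod 2)) := by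
  induction ω with
  | nil => simp [Function.End.one_def]
  | cons i ω ih =>
    rw [List.map_cons, List.prod_cons]
    change cs.signedStep i ((ω.map cs.signedStep).prod (t, ε)) = _
    rw [ih]
    have key : cs.wordProd ω * t * (cs.wordProd ω)⁻¹ = cs.simple i ↔
        (cs.wordProd ω)⁻¹ * cs.simple i * cs.wordProd ω = t := by
      rw [mul_inv_eq_iff_eq_mul, mul_assoc, inv_mul_eq_iff_eq_mul, eq_comm]
    simp only [signedStep, wordProd_cons, rightInvSeq, List.count_cons, key, beq_iff_eq]
    ext
    · simp [mul_assoc]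
    · push_cast
      simp [add_assoc]

theorem leftInvSeq_alternatingWord_eq_append (i j : B') :
    cs.leftInvSeq (alternatingWord i j (2 * M' i j)) =
      (List.range (M' i j)).map (fun k => cs.wordProd (alternatingWord j i (2 * k + 1))) ++
      (List.range (M' i j)).map (fun k => cs.wordProd (alternatingWord j i (2 * k + 1))) := by
  apply List.ext_getElem
  · simp; ring
  · intro k h₁ h₂
    have hk : k < 2 * M' i j := by simpa using h₁
    rw [getElem_leftInvSeq_alternatingWord _ _ _ _ _ hk]
    by_cases h : k < M' i j
    · rw [List.getElem_append_left (by simpa using h)]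
      simp
    · rw [List.getElem_append_right (by simpa using h)]
      simp only [List.length_map, List.length_range, List.getElem_map, List.getElem_range]
      obtain ⟨l, rfl⟩ := Nat.exists_eq_add_of_le (not_lt.mp h)
      rw [Nat.add_sub_cancel_left, prod_alternatingWord_eq_mul_pow,
        prod_alternatingWord_eq_mul_pow]
      have e₁ : (2 * (M' i j + l) + 1) / 2 = M' i j + l := by omega
      have e₂ : (2 * l + 1) / 2 = l := by omega
      rw [e₁, e₂, pow_add, simple_mul_simple_pow', one_mul]
      simp

theorem prod_map_alternatingWord {N : Type*} [Monoid N] (f : B' → N) (i j : B') (m : ℕ) :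
    ((alternatingWord i j (2 * m)).map f).prod = (f i * f j) ^ m := by
  induction m with
  | zero => simp [alternatingWord]
  | succ m ih =>
    rw [show 2 * (m + 1) = 2 * m + 1 + 1 by ring, alternatingWord_succ', alternatingWord_succ']
    simp [ih, pow_succ', mul_assoc]

theorem reverse_alternatingWord_two_mul (i j : B') (m : ℕ) :
    (alternatingWord i j (2 * m)).reverse = alternatingWord j i (2 * m) := by
  induction m with
  | zero => simp [alternatingWord]
  | succ m ih =>
    rw [show 2 * (m + 1) = 2 * m + 1 + 1 by ring, alternatingWord_succ', alternatingWord_succ',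
      alternatingWord_succ, alternatingWord_succ]
    simp [ih]

theorem isLiftable_signedStep : M'.IsLiftable cs.signedStep := by
  intro i j
  funext ⟨t, ε⟩
  have hcount : ((cs.rightInvSeq (alternatingWord i j (2 * M' i j))).count t : ZMod 2) = 0 := by
    rw [← reverse_alternatingWord_two_mul j i, rightInvSeq_reverse, List.count_reverse,
      M'.symmetric i j, leftInvSeq_alternatingWord_eq_append, List.count_append, Nat.cast_add]
    exact CharTwo.add_self_eq_zero _
  have hprod : cs.wordProd (alternatingWord i j (2 * M' i j)) = 1 := by
    simp [prod_alternatingWord_eq_mul_pow]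
  rw [← prod_map_alternatingWord, prod_map_signedStep, hcount, hprod]
  simp [Function.End.one_def]

/-- The action of the group on signed group elements. -/
noncomputable def signedAction : W' →* Function.End (W' × ZMod 2) :=
  cs.lift ⟨cs.signedStep, cs.isLiftable_signedStep⟩

theorem signedAction_wordProd (ω : List B') (t : W') (ε : ZMod 2) :
    cs.signedAction (cs.wordProd ω) (t, ε) =
      (cs.wordProd ω * t * (cs.wordProd ω)⁻¹, ε + ((cs.rightInvSeq ω).count t : ZMod 2)) := by
  have h : ⇑cs.signedAction ∘ cs.simple = cs.signedStep :=
    funext fun i => cs.lift_apply_simple _ i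
  rw [← prod_map_signedStep, wordProd, map_list_prod, List.map_map, h]

/-- Whether the wall of `t` separates `w` from the identity. -/
noncomputable def wallSide (w t : W') : ZMod 2 := (cs.signedAction w⁻¹ (t, 0)).2

theorem signedAction_inv (w t : W') (ε : ZMod 2) :
    cs.signedAction w⁻¹ (t, ε) = (w⁻¹ * t * w, ε + cs.wallSide w t) := by
  obtain ⟨ω, hω⟩ := cs.wordProd_surjective w⁻¹
  rw [wallSide, ← hω, signedAction_wordProd, signedAction_wordProd, hω]
  simp

theorem wallSide_mul (x y t : W') :
    cs.wallSide (x * y) t = cs.wallSide x t + cs.wallSide y (x⁻¹ * t * x) := by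
  rw [wallSide, mul_inv_rev, map_mul]
  change (cs.signedAction y⁻¹ (cs.signedAction x⁻¹ (t, 0))).2 = _
  rw [signedAction_inv, signedAction_inv, zero_add]

theorem wallSide_wordProd (ω : List B') (t : W') :
    cs.wallSide (cs.wordProd ω) t = ((cs.leftInvSeq ω).count t : ZMod 2) := by
  rw [wallSide, ← wordProd_reverse, signedAction_wordProd, rightInvSeq_reverse,
    List.count_reverse, zero_add]

theorem mem_leftInvSeq_of_wallSide_ne_zero {ω : List B'} {t : W'}
    (h : cs.wallSide (cs.wordProd ω) t ≠ 0) : t ∈ cs.leftInvSeq ω := by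
  rw [wallSide_wordProd] at h
  by_contra hmem
  exact h (by rw [List.count_eq_zero_of_not_mem hmem, Nat.cast_zero])

theorem length_mul_lt_of_wallSide_ne_zero {w t : W'} (h : cs.wallSide w t ≠ 0) :
    cs.length (t * w) < cs.length w := by
  obtain ⟨ω, hω, rfl⟩ := cs.exists_isReduced w
  exact (cs.isLeftInversion_of_mem_leftInvSeq hω (cs.mem_leftInvSeq_of_wallSide_ne_zero h)).2

theorem wallSide_simple (i : B') (t : W') :
    cs.wallSide (cs.simple i) t = if t = cs.simple i then 1 else 0 := by
  rw [← wordProd_singleton, wallSide_wordProd, leftInvSeq_singleton, List.count_singleton,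
    wordProd_singleton]
  by_cases h : t = cs.simple i
  · simp [h]
  · simp [h, Ne.symm h]

theorem wallSide_simple_ne_zero_iff (w : W') (i : B') :
    cs.wallSide w (cs.simple i) ≠ 0 ↔ cs.length (cs.simple i * w) < cs.length w := by
  refine ⟨cs.length_mul_lt_of_wallSide_ne_zero, fun h h₀ => ?_⟩
  have h₁ : cs.wallSide (cs.simple i * w) (cs.simple i) ≠ 0 := by
    rw [wallSide_mul, wallSide_simple]
    simp [h₀]
  have h₂ := cs.length_mul_lt_of_wallSide_ne_zero h₁
  rw [simple_mul_simple_cancel_left] at h₂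
  omega

/-- The sides of the walls of the Coxeter complex. -/
noncomputable def wallSides : WallSides W' where
  side := cs.wallSide
  rank := cs.length
  side_mul := cs.wallSide_mul
  eq_one w h := by
    by_contra hw
    obtain ⟨i, hi⟩ := cs.exists_leftDescent_of_ne_one hw
    exact (cs.wallSide_simple_ne_zero_iff w i).mpr hi (h _)
  rank_lt _ _ := cs.length_mul_lt_of_wallSide_ne_zero

end SignedReflections

end CoxeterSystem

namespace WallSides

variable {G : Type*} [Group G] (S : WallSides G)

theorem side_mul_left_eq_iff (g x y t : G) :
    S.side (g * x) t = S.side (g * y) t ↔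
      S.side x (g⁻¹ * t * g) = S.side y (g⁻¹ * t * g) := by
  rw [S.side_mul, S.side_mul, add_right_inj]

theorem eq_of_side_eq {x y : G} (h : ∀ t, S.side x t = S.side y t) : x = y := by
  refine (inv_mul_eq_one.mp (S.eq_one _ fun t => ?_))
  have key := S.side_mul x (x⁻¹ * y) (x * t * x⁻¹)
  rw [mul_inv_cancel_left, ← h, left_eq_add] at key
  simpa [mul_assoc] using key

/-- No wall indexed by `P` separates `x` from `y`. -/
def SameSide (P : Subgroup G) (x y : G) : Prop := ∀ t ∈ P, S.side x t = S.side y t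

variable {S} {P Q : Subgroup G} {a b g x y z : G}

theorem SameSide.symm (h : S.SameSide P x y) : S.SameSide P y x := fun t ht => (h t ht).symm

theorem SameSide.trans (h : S.SameSide P x y) (h' : S.SameSide P y z) : S.SameSide P x z :=
  fun t ht => (h t ht).trans (h' t ht)

theorem SameSide.mono (h : S.SameSide P x y) (hQ : Q ≤ P) : S.SameSide Q x y :=
  fun t ht => h t (hQ ht)

theorem SameSide.mul_left (h : S.SameSide P x y) (g : G) (hQ : ∀ t ∈ Q, g⁻¹ * t * g ∈ P) :
    S.SameSide Q (g * x) (g * y) :=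
  fun t ht => (S.side_mul_left_eq_iff g x y t).mpr (h _ (hQ t ht))

theorem SameSide.mul_left_of_mem (h : S.SameSide P x y) (hg : g ∈ P) :
    S.SameSide P (g * x) (g * y) :=
  h.mul_left g fun _ ht => P.mul_mem (P.mul_mem (P.inv_mem hg) ht) hg

variable (S P x y) in
theorem exists_sameSide [Finite G] : ∃ p ∈ P, S.SameSide P (p * x) y := by
  obtain ⟨p, hp, hmin⟩ := Set.exists_min_image (P : Set G) (fun p => S.rank (y⁻¹ * (p * x)))
    (Set.toFinite _) ⟨1, P.one_mem⟩
  refine ⟨p, hp, fun t ht => ?_⟩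
  by_contra hne
  have h₁ : S.side (y⁻¹ * (p * x)) (y⁻¹ * t * y) ≠ 0 := by
    intro h
    have key := S.side_mul y (y⁻¹ * (p * x)) t
    rw [h, add_zero, mul_inv_cancel_left] at key
    exact hne key
  have h₂ := S.rank_lt _ _ h₁
  have h₃ := hmin (t * p) (P.mul_mem ht hp)
  simp only [mul_assoc, mul_inv_cancel_left] at h₂ h₃
  omega

variable (S) in
/-- All chambers of the orbit `P * g` lie on the same side of every wall not indexed by `P`. -/
def IsGate (P : Subgroup G) (g : G) : Prop := ∀ p ∈ P, ∀ t ∉ P, S.side (p * g) t = S.side g t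

theorem IsGate.mul_left_of_mem (h : S.IsGate P g) (hx : x ∈ P) : S.IsGate P (x * g) :=
  fun p hp t ht => by rw [← mul_assoc, h _ (P.mul_mem hp hx) t ht, h x hx t ht]

theorem IsGate.eq_of_sameSide (h : S.IsGate P g) (hx : x ∈ P) (hy : y ∈ P)
    (hxy : S.SameSide P (x * g) (y * g)) : x = y := by
  refine mul_right_cancel (b := g) (S.eq_of_side_eq fun t => ?_)
  by_cases ht : t ∈ P
  · exact hxy t ht
  · rw [h x hx t ht, h y hy t ht]

theorem IsGate.comap_conj (h : S.IsGate P g) (x : G) :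
    S.IsGate (P.comap (MulAut.conj x).toMonoidHom) (x⁻¹ * g) := by
  intro p hp t ht
  simp only [Subgroup.mem_comap, MulEquiv.coe_toMonoidHom, MulAut.conj_apply] at hp ht
  rw [show p * (x⁻¹ * g) = x⁻¹ * (x * p * x⁻¹ * g) by group, side_mul_left_eq_iff]
  exact h _ hp _ (by simpa using ht)

theorem IsGate.exists_inf [Finite G] (hP : S.IsGate P x) (hQ : S.IsGate Q y) :
    ∃ g, S.IsGate (P ⊓ Q) g := by
  obtain ⟨q, hq, hqx⟩ := S.exists_sameSide Q y x
  have hgate := hQ.mul_left_of_mem hq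
  refine ⟨q * y, fun p hp t ht => ?_⟩
  by_cases htQ : t ∈ Q
  · have htP : t ∉ P := fun h => ht ⟨h, htQ⟩
    rw [hqx t htQ, hqx.mul_left_of_mem hp.2 t htQ, hP p hp.1 t htP]
  · exact hgate p hp.2 t htQ

variable (S) in
/-- A subgroup whose orbits on chambers contain the star of a face. -/
def IsGated (P : Subgroup G) : Prop := ∃ g, S.IsGate P g

theorem IsGated.eq_of_sameSide [Finite G] (h : S.IsGated P) (hx : x ∈ P) (hy : y ∈ P)
    (hxy : S.SameSide P (x * z) (y * z)) : x = y := by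
  obtain ⟨g, hg⟩ := h
  obtain ⟨p, hp, hpz⟩ := S.exists_sameSide P g z
  exact (hg.mul_left_of_mem hp).eq_of_sameSide hx hy
    (((hpz.mul_left_of_mem hx).trans hxy).trans (hpz.mul_left_of_mem hy).symm)

theorem IsGated.inf [Finite G] (hP : S.IsGated P) (hQ : S.IsGated Q) : S.IsGated (P ⊓ Q) :=
  hP.choose_spec.exists_inf hQ.choose_spec

theorem isGated_top : S.IsGated ⊤ := ⟨1, fun _ _ _ ht => (ht trivial).elim⟩

theorem IsGated.comap_conj (h : S.IsGated P) (x : G) :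
    S.IsGated (P.comap (MulAut.conj x).toMonoidHom) :=
  ⟨_, h.choose_spec.comap_conj x⟩

theorem IsGated.biInf [Finite G] {f : G → Subgroup G} (s : Finset G)
    (h : ∀ x ∈ s, S.IsGated (f x)) : S.IsGated (⨅ x ∈ s, f x) := by
  induction s using Finset.induction_on with
  | empty => simpa using isGated_top
  | insert x s _ ih =>
    rw [Finset.iInf_insert]
    exact (h x (by simp)).inf (ih fun y hy => h y (by simp [hy]))

/-- The largest subgroup of `P` normalised by `b`. -/
def cyclicCore (P : Subgroup G) (b : G) : Subgroup G :=
  ⨅ g ∈ Subgroup.zpowers b, P.comap (MulAut.conj g).toMonoidHom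

theorem mem_cyclicCore : x ∈ cyclicCore P b ↔ ∀ g ∈ Subgroup.zpowers b, g * x * g⁻¹ ∈ P := by
  simp [cyclicCore, Subgroup.mem_iInf]

theorem cyclicCore_le : cyclicCore P b ≤ P := fun x hx => by
  simpa using mem_cyclicCore.mp hx 1 (Subgroup.one_mem _)

theorem conj_mem_cyclicCore (hx : x ∈ cyclicCore P b) : b * x * b⁻¹ ∈ cyclicCore P b := by
  refine mem_cyclicCore.mpr fun g hg => ?_
  have := mem_cyclicCore.mp hx (g * b) (Subgroup.mul_mem _ hg (Subgroup.mem_zpowers b))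
  simpa [mul_assoc] using this

theorem inv_conj_mem_cyclicCore (hx : x ∈ cyclicCore P b) : b⁻¹ * x * b ∈ cyclicCore P b := by
  refine mem_cyclicCore.mpr fun g hg => ?_
  have := mem_cyclicCore.mp hx (g * b⁻¹)
    (Subgroup.mul_mem _ hg (Subgroup.inv_mem _ (Subgroup.mem_zpowers b)))
  simpa [mul_assoc] using this

theorem mem_cyclicCore_of_pow [Finite G]
    (h : ∀ k < orderOf b, (b ^ k)⁻¹ * x * b ^ k ∈ P) : x ∈ cyclicCore P b := by
  refine mem_cyclicCore.mpr fun g hg => ?_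
  obtain ⟨k, hk, hkg⟩ := Finset.mem_image.mp
    (mem_zpowers_iff_mem_range_orderOf.mp (Subgroup.inv_mem _ hg))
  have := h k (Finset.mem_range.mp hk)
  simp only [hkg] at this
  simpa using this

theorem le_cyclicCore [Finite G] (hPQ : P ≤ Q) (h : ∀ x ∈ P, b * x * b⁻¹ ∈ P) :
    P ≤ cyclicCore Q b := by
  intro x hx
  have hpow : ∀ k : ℕ, b ^ k * x * (b ^ k)⁻¹ ∈ P := by
    intro k
    induction k with
    | zero => simpa
    | succ k ih => simpa [pow_succ', mul_assoc] using h _ ih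
  refine mem_cyclicCore.mpr fun g hg => hPQ ?_
  obtain ⟨k, _, rfl⟩ := Finset.mem_image.mp (mem_zpowers_iff_mem_range_orderOf.mp hg)
  exact hpow k

theorem cyclicCore_le_cyclicCore_mul [Finite G] (hz : z ∈ cyclicCore Q a) :
    cyclicCore Q a ≤ cyclicCore Q (a * z) :=
  le_cyclicCore cyclicCore_le fun x hx => by
    have := conj_mem_cyclicCore
      (Subgroup.mul_mem _ (Subgroup.mul_mem _ hz hx) (Subgroup.inv_mem _ hz))
    simpa [mul_assoc] using this

theorem cyclicCore_mul [Finite G] (hz : z ∈ cyclicCore Q a) :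
    cyclicCore Q (a * z) = cyclicCore Q a := by
  refine le_antisymm ?_ (cyclicCore_le_cyclicCore_mul hz)
  have := cyclicCore_le_cyclicCore_mul (Subgroup.inv_mem _ (cyclicCore_le_cyclicCore_mul hz hz))
  rwa [mul_inv_cancel_right] at this

theorem mem_cyclicCore_of_commute (hb : b ∈ Q) (hab : Commute a b) : b ∈ cyclicCore Q a := by
  refine mem_cyclicCore.mpr fun g hg => ?_
  obtain ⟨k, rfl⟩ := Subgroup.mem_zpowers_iff.mp hg
  rwa [(hab.zpow_left k).eq, mul_inv_cancel_right]

theorem IsGated.cyclicCore [Finite G] (h : S.IsGated P) (b : G) :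
    S.IsGated (cyclicCore P b) := by
  have := Fintype.ofFinite G
  have key := IsGated.biInf (S := S) (f := fun g => P.comap (MulAut.conj g).toMonoidHom)
    (Finset.univ.filter (· ∈ Subgroup.zpowers b)) fun x _ => h.comap_conj x
  simpa [WallSides.cyclicCore] using key

theorem IsGate.exists_fixed [Finite G] (hg : S.IsGate P g)
    (hx : S.SameSide (WallSides.cyclicCore P b) (b * x) x) :
    ∃ p ∈ P, S.SameSide P (b * (p * g)) (p * g) := by
  have hex : ∀ y, ∃ p ∈ P, S.SameSide P (p * g) y := fun y => S.exists_sameSide P g y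
  choose f hf hfs using hex
  let c : ℕ → G := fun n => Nat.rec (f x) (fun _ p => f (b * (p * g))) n
  have hc : ∀ n, c n ∈ P := fun n => by cases n <;> exact hf _
  have hstep : ∀ n, S.SameSide P (c (n + 1) * g) (b * (c n * g)) := fun n => hfs _
  have hcore : ∀ n, S.SameSide (WallSides.cyclicCore P b) (c n * g) x := by
    intro n
    induction n with
    | zero => exact (hfs x).mono cyclicCore_le
    | succ n ih =>
      exact (((hstep n).mono cyclicCore_le).trans
        (ih.mul_left b fun _ => inv_conj_mem_cyclicCore)).trans hx
  have hsep : ∀ n t, S.side (c n * g) t ≠ S.side (c (n + 1) * g) t →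
      ∀ k ≤ n, (b ^ k)⁻¹ * t * b ^ k ∈ P := by
    intro n
    induction n with
    | zero =>
      intro t ht k hk
      obtain rfl : k = 0 := by omega
      by_contra h
      rw [pow_zero, inv_one, one_mul, mul_one] at h
      rw [hg _ (hc 0) t h, hg _ (hc (0 + 1)) t h] at ht
      exact ht rfl
    | succ n ih =>
      intro t ht k hk
      have htP : t ∈ P := by
        by_contra h
        rw [hg _ (hc (n + 1)) t h, hg _ (hc (n + 1 + 1)) t h] at ht
        exact ht rfl
      rw [hstep n t htP, hstep (n + 1) t htP, Ne, side_mul_left_eq_iff] at ht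
      cases k with
      | zero => simpa
      | succ k =>
        have := ih _ ht k (by omega)
        simpa [pow_succ', mul_assoc] using this
  refine ⟨c (orderOf b), hc _, fun t ht => ?_⟩
  by_contra hne
  rw [← hstep _ t ht] at hne
  have htc := mem_cyclicCore_of_pow fun k hk => hsep _ t (Ne.symm hne) k hk.le
  exact hne ((hcore (orderOf b + 1) t htc).trans (hcore (orderOf b) t htc).symm)

theorem IsGate.eq_of_sameSide_cyclicCore [Finite G] (hg : S.IsGate P g) (hx : x ∈ P) (hy : y ∈ P)
    (hbx : S.SameSide P (b * (x * g)) (x * g)) (hby : S.SameSide P (b * (y * g)) (y * g))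
    (hxy : S.SameSide (WallSides.cyclicCore P b) (x * g) (y * g)) : x = y := by
  have hmem : ∀ t, S.side (x * g) t ≠ S.side (y * g) t → t ∈ P := by
    intro t ht
    by_contra h
    rw [hg x hx t h, hg y hy t h] at ht
    exact ht rfl
  refine hg.eq_of_sameSide hx hy fun t _ => ?_
  by_contra ht
  have hsep : ∀ k : ℕ, S.side (x * g) ((b ^ k)⁻¹ * t * b ^ k) ≠
      S.side (y * g) ((b ^ k)⁻¹ * t * b ^ k) := by
    intro k
    induction k with
    | zero => simpa using ht
    | succ k ih =>
      have hP := hmem _ ih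
      rw [← hbx _ hP, ← hby _ hP, Ne, side_mul_left_eq_iff] at ih
      simpa [pow_succ, mul_assoc] using ih
  exact ht (hxy t (mem_cyclicCore_of_pow fun k _ => hmem _ (hsep k)))

theorem IsGate.exists_commute [Finite G] (hg : S.IsGate P g) (hx : x ∈ P) (hy : y ∈ P)
    (hbx : S.SameSide P (b * (x * g)) (x * g)) (hby : S.SameSide P (b * (y * g)) (y * g)) :
    ∃ a ∈ P, Commute a b ∧ a * x = y := by
  obtain ⟨q, hq, hqs⟩ := S.exists_sameSide (WallSides.cyclicCore P b) (x * g) (y * g)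
  have hqP := cyclicCore_le hq
  have hcomm : b * q * b⁻¹ = q := by
    refine (IsGated.cyclicCore ⟨g, hg⟩ b).eq_of_sameSide (S := S) (z := x * g)
      (conj_mem_cyclicCore hq) hq ?_
    have h₁ := ((hbx.mono cyclicCore_le).symm.mul_left_of_mem (conj_mem_cyclicCore hq))
    have h₂ := hqs.mul_left b (Q := WallSides.cyclicCore P b) fun _ => inv_conj_mem_cyclicCore
    rw [show b * q * b⁻¹ * (b * (x * g)) = b * (q * (x * g)) by group] at h₁
    exact ((h₁.trans h₂).trans (hby.mono cyclicCore_le)).trans hqs.symm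
  have hqb : b * q = q * b := mul_inv_eq_iff_eq_mul.mp hcomm
  refine ⟨q, hqP, hqb.symm, hg.eq_of_sameSide_cyclicCore (P.mul_mem hqP hx) hy ?_ hby ?_⟩
  · have := hbx.mul_left_of_mem hqP
    rwa [← mul_assoc q b, ← hqb, mul_assoc b q, ← mul_assoc q x] at this
  · rwa [mul_assoc]

theorem IsGated.exists_fixed_of_inf [Finite G] (hQ : S.IsGated Q) (hb : b ∈ Q)
    (hx : S.SameSide (P ⊓ Q) (b * x) x) : ∃ y, S.SameSide P (b * y) y := by
  obtain ⟨g, hg⟩ := hQ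
  obtain ⟨q, hq, hqx⟩ := S.exists_sameSide Q g x
  refine ⟨q * g, fun t ht => ?_⟩
  by_cases htQ : t ∈ Q
  · rw [hqx.mul_left_of_mem hb t htQ, hqx t htQ, hx t ⟨ht, htQ⟩]
  · exact hg.mul_left_of_mem hq b hb t htQ

end WallSides

theorem Set.ncard_eq_sum_ncard_fiber {α β : Type*} [Fintype α] [Finite β] (s : Set (α × β)) :
    s.ncard = ∑ a, {b | (a, b) ∈ s}.ncard := by
  have e : s ≃ Σ a, {b | (a, b) ∈ s} :=
    { toFun := fun x => ⟨x.1.1, x.1.2, x.2⟩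
      invFun := fun x => ⟨(x.1, x.2.1), x.2.2⟩
      left_inv := fun _ => rfl
      right_inv := fun _ => rfl }
  rw [← Nat.card_coe_set_eq, Nat.card_congr e, Nat.card_sigma]
  simp only [Nat.card_coe_set_eq]

theorem Set.ncard_eq_of_ncard_fiber_eq {α β γ : Type*} [Finite α] [Finite β] [Finite γ]
    {s : Set (α × β)} {t : Set (α × γ)}
    (h : ∀ a, {b | (a, b) ∈ s}.ncard = {c | (a, c) ∈ t}.ncard) : s.ncard = t.ncard := by
  have := Fintype.ofFinite α
  rw [s.ncard_eq_sum_ncard_fiber, t.ncard_eq_sum_ncard_fiber]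
  exact Finset.sum_congr rfl fun a _ => h a

namespace WallSides

variable {G : Type*} [Group G] {S : WallSides G} {P Q : Subgroup G} {a b g x y z : G}

theorem IsGated.commute_of_fixed [Finite G] (h : S.IsGated P) (hP : ∀ t ∈ P, b * t * b⁻¹ ∈ P)
    (hx : S.SameSide P (b * x) x) (hy : y ∈ P)
    (hyx : S.SameSide P (b * (y * x)) (y * x)) : Commute y b := by
  refine (mul_inv_eq_iff_eq_mul.mp (h.eq_of_sameSide (z := x) (hP y hy) hy ?_)).symm
  have h₁ := hx.symm.mul_left_of_mem (hP y hy)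
  rw [show b * y * b⁻¹ * (b * x) = b * (y * x) by group] at h₁
  exact h₁.trans hyx

/-- The largest subgroup of `P` normalised by `b` met with the largest subgroup of `Q` normalised
by `a`. -/
def biCore (P Q : Subgroup G) (a b : G) : Subgroup G := cyclicCore P b ⊓ cyclicCore Q a

theorem biCore_comm : biCore P Q a b = biCore Q P b a := inf_comm _ _

theorem IsGated.biCore [Finite G] (hP : S.IsGated P) (hQ : S.IsGated Q) :
    S.IsGated (biCore P Q a b) := (hP.cyclicCore b).inf (hQ.cyclicCore a)

theorem biCore_mul [Finite G] (hz : z ∈ biCore P Q a b) :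
    biCore P Q (a * z) b = biCore P Q a b := by
  rw [biCore, cyclicCore_mul hz.2, biCore]

theorem conj_mem_biCore_left (ha : a ∈ P) (hab : Commute a b) (hz : z ∈ biCore P Q a b) :
    a * z * a⁻¹ ∈ biCore P Q a b := by
  have h := mem_cyclicCore_of_commute ha hab.symm
  exact ⟨Subgroup.mul_mem _ (Subgroup.mul_mem _ h hz.1) (Subgroup.inv_mem _ h),
    conj_mem_cyclicCore hz.2⟩

theorem inv_conj_mem_biCore_left (ha : a ∈ P) (hab : Commute a b) (hz : z ∈ biCore P Q a b) :
    a⁻¹ * z * a ∈ biCore P Q a b := by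
  have h := mem_cyclicCore_of_commute ha hab.symm
  exact ⟨Subgroup.mul_mem _ (Subgroup.mul_mem _ (Subgroup.inv_mem _ h) hz.1) h,
    inv_conj_mem_cyclicCore hz.2⟩

theorem conj_mem_biCore_right (hb : b ∈ Q) (hab : Commute a b) (hz : z ∈ biCore P Q a b) :
    b * z * b⁻¹ ∈ biCore P Q a b := by
  rw [biCore_comm] at hz ⊢
  exact conj_mem_biCore_left hb hab.symm hz

theorem inv_conj_mem_biCore_right (hb : b ∈ Q) (hab : Commute a b) (hz : z ∈ biCore P Q a b) :
    b⁻¹ * z * b ∈ biCore P Q a b := by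
  rw [biCore_comm] at hz ⊢
  exact inv_conj_mem_biCore_left hb hab.symm hz

variable (S) in
/-- Commuting pairs `(a, b) ∈ P × Q` with a chamber of their common core fixed by both. -/
def IsFixedPair (P Q : Subgroup G) (a b p : G) : Prop :=
  a ∈ P ∧ b ∈ Q ∧ Commute a b ∧ p ∈ biCore P Q a b ∧
    S.SameSide (biCore P Q a b) (a * p) p ∧ S.SameSide (biCore P Q a b) (b * p) p

theorem isFixedPair_comm {p : G} : S.IsFixedPair P Q a b p ↔ S.IsFixedPair Q P b a p := by
  rw [IsFixedPair, IsFixedPair, biCore_comm (P := Q), Commute.symm_iff (a := b)]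
  tauto

theorem IsGate.ncard_fixed_eq_ncard_commute [Finite G] (hg : S.IsGate P g) (hx : x ∈ P)
    (hbx : S.SameSide P (b * (x * g)) (x * g)) :
    {p | p ∈ P ∧ S.SameSide P (b * (p * g)) (p * g)}.ncard =
      {a | a ∈ P ∧ Commute a b}.ncard := by
  refine (Set.ncard_congr (fun a _ => a * x) ?_ ?_ ?_).symm
  · rintro a ⟨ha, hab⟩
    refine ⟨P.mul_mem ha hx, ?_⟩
    have := hbx.mul_left_of_mem ha
    rwa [← mul_assoc, hab.eq, mul_assoc, ← mul_assoc a] at this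
  · exact fun a a' _ _ h => mul_right_cancel h
  · rintro p ⟨hp, hbp⟩
    obtain ⟨a, ha, hab, rfl⟩ := hg.exists_commute hx hp hbx hbp
    exact ⟨a, ⟨ha, hab⟩, rfl⟩

theorem ncard_isFixedPair_eq_ncard_commute [Finite G] (hP : S.IsGated P) (hQ : S.IsGated Q)
    (hb : b ∈ Q) (hx : S.SameSide P (b * x) x) :
    {r : G × G | S.IsFixedPair P Q r.1 b r.2}.ncard = {a | a ∈ P ∧ Commute a b}.ncard := by
  have hle : ∀ a, biCore P Q a b ≤ P := fun a => inf_le_left.trans cyclicCore_le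
  have hex : ∀ r : G × G, ∃ z ∈ biCore P Q r.1 b, S.SameSide (biCore P Q r.1 b) (z * x) r.2 :=
    fun r => S.exists_sameSide _ x r.2
  choose f hf hfs using hex
  have hfix : ∀ r : G × G, S.IsFixedPair P Q r.1 b r.2 →
      S.SameSide (biCore P Q r.1 b) (r.1 * f r * x) (f r * x) := by
    rintro r ⟨ha, -, hab, -, hap, -⟩
    have := (hfs r).mul_left r.1 fun _ => inv_conj_mem_biCore_left ha hab
    rw [← mul_assoc] at this
    exact (this.trans hap).trans (hfs r).symm
  refine Set.ncard_congr (fun r _ => r.1 * f r) ?_ ?_ ?_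
  · rintro r ⟨ha, -, hab, hp, hap, hbp⟩
    refine ⟨P.mul_mem ha (hle _ (hf r)), hab.mul_left ?_⟩
    have hbz := (hfs r).mul_left b fun _ => inv_conj_mem_biCore_right hb hab
    exact (hP.biCore hQ).commute_of_fixed (fun _ => conj_mem_biCore_right hb hab)
      (hx.mono (hle _)) (hf r)
      ((hbz.trans hbp).trans (hfs r).symm)
  · intro r r' hr hr' h
    have hZ : biCore P Q r.1 b = biCore P Q r'.1 b := by
      rw [← biCore_mul (hf r), ← biCore_mul (hf r')]
      exact congrArg (biCore P Q · b) h
    have h₁ := hfix r hr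
    have h₂ := hfix r' hr'
    have h₃ := hfs r'
    have h₄ := hf r'
    have h₅ := hr'.2.2.2.1
    rw [← hZ] at h₂ h₃ h₄ h₅
    rw [← h] at h₂
    have hff : f r = f r' := (hP.biCore hQ).eq_of_sameSide (hf r) h₄ (h₁.symm.trans h₂)
    refine Prod.ext (mul_right_cancel (hff ▸ h)) ((hP.biCore hQ).eq_of_sameSide (z := 1)
      hr.2.2.2.1 h₅ ?_)
    rw [mul_one, mul_one]
    rw [← hff] at h₃
    exact (hfs r).symm.trans h₃
  · rintro a ⟨ha, hab⟩
    obtain ⟨y, hy, hys⟩ := S.exists_sameSide (biCore P Q a b) x (a * x)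
    obtain ⟨p, hp, hps⟩ := S.exists_sameSide (biCore P Q a b) 1 (y * x)
    rw [mul_one] at hps
    have hbx := hx.mono (hle a)
    have hby : S.SameSide (biCore P Q a b) (b * (y * x)) (y * x) := by
      have h₁ := hys.mul_left b fun _ => inv_conj_mem_biCore_right hb hab
      have h₂ := hbx.mul_left a fun _ => inv_conj_mem_biCore_left ha hab
      rw [← mul_assoc, hab.eq, mul_assoc] at h₂
      exact (h₁.trans h₂).trans hys.symm
    have hyb : Commute y b := (hP.biCore hQ).commute_of_fixed
      (fun _ => conj_mem_biCore_right hb hab) hbx hy hby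
    have hZ : biCore P Q (a * y⁻¹) b = biCore P Q a b := biCore_mul (Subgroup.inv_mem _ hy)
    have hab' : Commute (a * y⁻¹) b := hab.mul_left hyb.inv_left
    have ha' : a * y⁻¹ ∈ P := P.mul_mem ha (P.inv_mem (hle _ hy))
    have hr : S.IsFixedPair P Q (a * y⁻¹) b p := by
      refine ⟨ha', hb, hab', hZ ▸ hp, ?_, ?_⟩
      · have h₁ := (hZ ▸ hps).mul_left (a * y⁻¹) fun _ => inv_conj_mem_biCore_left ha' hab'
        rw [show a * y⁻¹ * (y * x) = a * x by group] at h₁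
        rw [hZ] at h₁ ⊢
        exact (h₁.trans hys.symm).trans hps.symm
      · rw [hZ]
        exact ((hps.mul_left b fun _ => inv_conj_mem_biCore_right hb hab).trans hby).trans hps.symm
    refine ⟨(a * y⁻¹, p), hr, ?_⟩
    have h₁ := hf (a * y⁻¹, p)
    have h₂ := hfs (a * y⁻¹, p)
    simp only [hZ] at h₁ h₂ ⊢
    rw [(hP.biCore hQ).eq_of_sameSide h₁ hy (h₂.trans hps), inv_mul_cancel_right]

theorem IsGate.ncard_fixed_eq_ncard_isFixedPair [Finite G] (hg : S.IsGate P g)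
    (hQ : S.IsGated Q) (hb : b ∈ Q) :
    {p | p ∈ P ∧ S.SameSide P (b * (p * g)) (p * g)}.ncard =
      {r : G × G | S.IsFixedPair P Q r.1 b r.2}.ncard := by
  by_cases h : ∃ x ∈ P, S.SameSide P (b * (x * g)) (x * g)
  · obtain ⟨x, hx, hbx⟩ := h
    rw [hg.ncard_fixed_eq_ncard_commute hx hbx, ncard_isFixedPair_eq_ncard_commute ⟨g, hg⟩ hQ hb hbx]
  · have h₁ : {p | p ∈ P ∧ S.SameSide P (b * (p * g)) (p * g)} = ∅ :=
      Set.eq_empty_of_forall_notMem fun p hp => h ⟨p, hp⟩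
    have h₂ : {r : G × G | S.IsFixedPair P Q r.1 b r.2} = ∅ := by
      refine Set.eq_empty_of_forall_notMem ?_
      rintro r ⟨-, -, hab, -, -, hbp⟩
      obtain ⟨y, hy⟩ := (hQ.cyclicCore r.1).exists_fixed_of_inf
        (mem_cyclicCore_of_commute hb hab) hbp
      exact h (hg.exists_fixed hy)
    rw [h₁, h₂, Set.ncard_empty, Set.ncard_empty]

variable (S) in
/-- Pairs of an element of `Q` and a chamber of the orbit `P * g` that it fixes modulo `P`. -/
def fixedPairs (P Q : Subgroup G) (g : G) : Set (G × G) :=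
  {r | r.1 ∈ Q ∧ r.2 ∈ P ∧ S.SameSide P (r.1 * (r.2 * g)) (r.2 * g)}

theorem IsGate.ncard_fixedPairs [Finite G] (hg : S.IsGate P g) (hQ : S.IsGated Q) :
    (S.fixedPairs P Q g).ncard = {r : G × G × G | S.IsFixedPair P Q r.2.1 r.1 r.2.2}.ncard := by
  refine Set.ncard_eq_of_ncard_fiber_eq fun b => ?_
  by_cases hb : b ∈ Q
  · simpa [fixedPairs, hb] using hg.ncard_fixed_eq_ncard_isFixedPair hQ hb
  · simp [fixedPairs, IsFixedPair, hb]

theorem IsGate.ncard_fixedPairs_comm [Finite G] (hx : S.IsGate P x) (hy : S.IsGate Q y) :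
    (S.fixedPairs P Q x).ncard = (S.fixedPairs Q P y).ncard := by
  rw [hx.ncard_fixedPairs ⟨y, hy⟩, hy.ncard_fixedPairs ⟨x, hx⟩]
  refine Set.ncard_congr (fun r _ => (r.2.1, r.1, r.2.2)) (fun _ => isFixedPair_comm.mp) ?_ ?_
  · rintro ⟨_, _, _⟩ ⟨_, _, _⟩ _ _ h
    simp_all
  · exact fun r hr => ⟨(r.2.1, r.1, r.2.2), isFixedPair_comm.mpr hr, rfl⟩

/-- The conjugate `v * P * v⁻¹`. -/
def conjBy (P : Subgroup G) (v : G) : Subgroup G := P.comap (MulAut.conj v⁻¹).toMonoidHom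

theorem mem_conjBy : x ∈ conjBy P y ↔ y⁻¹ * x * y ∈ P := by simp [conjBy]

theorem IsGate.conjBy (h : S.IsGate P 1) (v : G) : S.IsGate (conjBy P v) v := by
  have := h.comap_conj v⁻¹
  rwa [inv_inv, mul_one] at this

theorem sameSide_conjBy_iff : S.SameSide (conjBy P g) (g * x) (g * y) ↔ S.SameSide P x y := by
  refine ⟨fun h => ?_, fun h => h.mul_left g fun t => mem_conjBy.mp⟩
  simpa using h.mul_left g⁻¹ (Q := P) fun t ht => mem_conjBy.mpr (by simpa [mul_assoc] using ht)

theorem conjBy_mul_of_mem (hx : x ∈ P) : WallSides.conjBy P (g * x) = WallSides.conjBy P g := by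
  ext t
  rw [mem_conjBy, mem_conjBy, ← P.mul_mem_cancel_left hx, ← P.mul_mem_cancel_right (P.inv_mem hx)]
  simp [mul_assoc]

variable (S) in
/-- The fixed pairs of all pairs of conjugates of `P` and `Q`. -/
def conjFixedPairs (P Q : Subgroup G) : Set ((G × G) × (G × G)) :=
  {r | r.2 ∈ S.fixedPairs (conjBy P r.1.1) (conjBy Q r.1.2) r.1.1}

theorem IsGate.ncard_conjFixedPairs_comm [Finite G] (hP : S.IsGate P 1) (hQ : S.IsGate Q 1) :
    (S.conjFixedPairs P Q).ncard = (S.conjFixedPairs Q P).ncard := by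
  trans {r : (G × G) × (G × G) |
    r.2 ∈ S.fixedPairs (WallSides.conjBy Q r.1.2) (WallSides.conjBy P r.1.1) r.1.2}.ncard
  · refine Set.ncard_eq_of_ncard_fiber_eq fun v => ?_
    simpa only [conjFixedPairs, Set.mem_ofPred_eq, Set.ofPred_mem_eq] using
      (hP.conjBy v.1).ncard_fixedPairs_comm (hQ.conjBy v.2)
  · exact Set.ncard_congr (fun r _ => (r.1.swap, r.2)) (fun _ h => h)
      (fun r r' _ _ h => Prod.ext (Prod.swap_injective (congrArg Prod.fst h))
        (congrArg Prod.snd h :))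
      fun r hr => ⟨(r.1.swap, r.2), hr, rfl⟩

variable (S) in
/-- Pairs of an element `u` and a coset `x * Q` fixed by `u`, with both `u` and `x` distinguished
coset representatives, for `P` and `Q` respectively. -/
def distinguishedPairs (P Q : Subgroup G) : Set (G × G) :=
  {r | S.SameSide P r.1⁻¹ 1 ∧ S.SameSide Q r.2⁻¹ 1 ∧ r.2⁻¹ * r.1 * r.2 ∈ Q}

theorem IsGate.ncard_conjFixedPairs [Finite G] (hQ : S.IsGate Q 1) :
    (S.conjFixedPairs P Q).ncard =
      Nat.card P * (Nat.card G * (Nat.card Q * (S.distinguishedPairs P Q).ncard)) := by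
  have hprod : Nat.card P * (Nat.card G * (Nat.card Q * (S.distinguishedPairs P Q).ncard)) =
      ((P : Set G) ×ˢ (Set.univ : Set G) ×ˢ (Q : Set G) ×ˢ S.distinguishedPairs P Q).ncard := by
    simp only [Set.ncard_prod, Set.ncard_univ]
    rfl
  rw [hprod]
  refine (Set.ncard_congr (fun r _ => ((r.2.1 * r.1⁻¹, r.2.1 * (r.2.2.2.2 * r.2.2.1)),
    (r.2.1 * r.2.2.2.1⁻¹ * r.2.1⁻¹, r.2.1 * r.1 * r.2.1⁻¹))) ?_ ?_ ?_).symm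
  · rintro ⟨i, c, j, u, x⟩ ⟨hi, -, hj, hu, hx, hux⟩
    simp only [SetLike.mem_coe] at hi hj hux
    refine ⟨mem_conjBy.mpr ?_, mem_conjBy.mpr ?_, ?_⟩
    · have := Q.mul_mem (Q.mul_mem (Q.inv_mem hj) (Q.inv_mem hux)) hj
      simpa [mul_assoc] using this
    · simpa [mul_assoc] using hi
    · simp only [conjBy_mul_of_mem (P.inv_mem hi)]
      simpa [mul_assoc] using (sameSide_conjBy_iff (g := c)).mpr hu
  · rintro ⟨i, c, j, u, x⟩ ⟨i', c', j', u', x'⟩ ⟨hi, -, hj, hu, hx, hux⟩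
      ⟨hi', -, hj', hu', hx', hux'⟩ h
    simp only [Prod.mk.injEq] at h hj hj' hx hx' ⊢
    obtain ⟨⟨h₁, h₂⟩, h₃, h₄⟩ := h
    have hc : c = c' := by
      have : c * i * c⁻¹ * (c * i⁻¹) = c' * i' * c'⁻¹ * (c' * i'⁻¹) := by rw [h₁, h₄]
      simpa [mul_assoc] using this
    subst hc
    have hjx : j⁻¹ * x⁻¹ = j'⁻¹ * x'⁻¹ := by simpa using congrArg Inv.inv (mul_left_cancel h₂)
    have hjj : j⁻¹ = j'⁻¹ := hQ.eq_of_sameSide (Q.inv_mem hj) (Q.inv_mem hj') <| by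
      have e := hx.mul_left_of_mem (Q.inv_mem hj)
      rw [hjx] at e
      exact e.symm.trans (hx'.mul_left_of_mem (Q.inv_mem hj'))
    rw [hjj] at hjx
    simp_all
  · rintro ⟨⟨v, w⟩, b, p⟩ ⟨hb, hp, hbp⟩
    simp only [mem_conjBy] at hb hp hbp
    obtain ⟨q, hq, hqs⟩ := S.exists_sameSide Q 1 (w⁻¹ * (p * v))
    have hpv : WallSides.conjBy P v = WallSides.conjBy P (p * v) := by
      rw [← conjBy_mul_of_mem hp]
      congr 1
      group
    refine ⟨(v⁻¹ * p * v, p * v, q⁻¹, (p * v)⁻¹ * b⁻¹ * (p * v), (p * v)⁻¹ * w * q),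
      ⟨hp, trivial, Q.inv_mem hq, ?_, ?_, ?_⟩, ?_⟩
    · rw [hpv] at hbp
      have := (sameSide_conjBy_iff (g := p * v) (x := (p * v)⁻¹ * b * (p * v)) (y := 1)
        (S := S) (P := P)).mp (by simpa [mul_assoc] using hbp)
      simpa [mul_assoc] using this
    · have := hqs.symm.mul_left_of_mem (Q.inv_mem hq)
      simpa [mul_assoc] using this
    · have := Q.mul_mem (Q.mul_mem (Q.inv_mem hq) (Q.inv_mem hb)) hq
      simpa [mul_assoc] using this
    · simp [mul_assoc]

theorem IsGate.ncard_distinguishedPairs_comm [Finite G] (hP : S.IsGate P 1) (hQ : S.IsGate Q 1) :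
    (S.distinguishedPairs P Q).ncard = (S.distinguishedPairs Q P).ncard := by
  have h := hP.ncard_conjFixedPairs_comm hQ
  rw [hQ.ncard_conjFixedPairs, hP.ncard_conjFixedPairs] at h
  have hG := Nat.card_pos (α := G)
  have hP := Nat.card_pos (α := P)
  have hQ := Nat.card_pos (α := Q)
  refine Nat.eq_of_mul_eq_mul_left (Nat.mul_pos hP (Nat.mul_pos hG hQ)) ?_
  linarith

end WallSides

namespace CoxeterSystem

variable {B' W' : Type*} [Group W'] {M' : CoxeterMatrix B'} (cs : CoxeterSystem M' W')
  {J : Finset B'} {w : W'}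

theorem simple_mem_coxParabolic {i : B'} (hi : i ∈ J) : cs.simple i ∈ CoxParabolic cs J :=
  Subgroup.subset_closure ⟨i, hi, rfl⟩

theorem isGate_coxParabolic : cs.wallSides.IsGate (CoxParabolic cs J) 1 := by
  intro p hp
  rw [mul_one]
  have h1 : ∀ t, cs.wallSide 1 t = 0 := fun t => by simpa using cs.wallSide_mul 1 1 t
  have key : ∀ p ∈ CoxParabolic cs J, ∀ t ∉ CoxParabolic cs J, cs.wallSide p t = 0 := by
    intro p hp
    induction hp using Subgroup.closure_induction with
    | mem x hx =>
      obtain ⟨i, hi, rfl⟩ := hx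
      intro t ht
      rw [wallSide_simple, if_neg]
      rintro rfl
      exact ht (cs.simple_mem_coxParabolic hi)
    | one => exact fun t _ => h1 t
    | mul x y hx hy ihx ihy =>
      intro t ht
      rw [wallSide_mul, ihx t ht, zero_add]
      refine ihy _ fun h => ht ?_
      have : _ ∈ CoxParabolic cs J :=
        Subgroup.mul_mem _ (Subgroup.mul_mem _ hx h) (Subgroup.inv_mem _ hx)
      simpa [mul_assoc] using this
    | inv x hx ih =>
      intro t ht
      have h := cs.wallSide_mul x⁻¹ x t
      rw [inv_mul_cancel, h1, ih, add_zero] at h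
      · exact h.symm
      · intro h'
        have : _ ∈ CoxParabolic cs J :=
          Subgroup.mul_mem _ (Subgroup.mul_mem _ (Subgroup.inv_mem _ hx) h') hx
        exact ht (by simpa [mul_assoc] using this)
  exact fun t ht => (key p hp t ht).trans (h1 t).symm

theorem exists_reduced_of_mem_coxParabolic (hw : w ∈ CoxParabolic cs J) :
    ∃ ω : List B', cs.IsReduced ω ∧ cs.wordProd ω = w ∧ ∀ i ∈ ω, i ∈ J := by
  have hstep : ∀ i ∈ J, ∀ v, (∃ ω : List B', cs.IsReduced ω ∧ cs.wordProd ω = v ∧ ∀ i ∈ ω, i ∈ J) →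
      ∃ ω : List B', cs.IsReduced ω ∧ cs.wordProd ω = cs.simple i * v ∧ ∀ i ∈ ω, i ∈ J := by
    rintro i hi _ ⟨ω, hω, rfl, hJ⟩
    rcases cs.length_simple_mul (cs.wordProd ω) i with h | h
    · refine ⟨i :: ω, ?_, cs.wordProd_cons i ω, by simpa [hi] using hJ⟩
      rw [IsReduced, wordProd_cons, h, hω, List.length_cons]
    · have hmem := cs.mem_leftInvSeq_of_wallSide_ne_zero
        ((cs.wallSide_simple_ne_zero_iff (cs.wordProd ω) i).mpr (by omega))
      obtain ⟨k, hk, hki⟩ := List.mem_iff_getElem.mp hmem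
      have hlen : k < ω.length := by simpa using hk
      have hprod := cs.getD_leftInvSeq_mul_wordProd ω k
      rw [List.getD_eq_getElem _ _ hk, hki] at hprod
      refine ⟨ω.eraseIdx k, ?_, hprod.symm, fun j hj => hJ j (List.mem_of_mem_eraseIdx hj)⟩
      have := List.length_eraseIdx_add_one hlen
      rw [IsReduced, ← hprod]
      have := hω.symm
      omega
  induction hw using Subgroup.closure_induction_left with
  | one => exact ⟨[], by simp [IsReduced], by simp, by simp⟩
  | mul_left x hx y _ ih =>
    obtain ⟨i, hi, rfl⟩ := hx
    exact hstep i hi y ih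
  | inv_mul_cancel x hx y _ ih =>
    obtain ⟨i, hi, rfl⟩ := hx
    rw [inv_simple]
    exact hstep i hi y ih

theorem exists_length_simple_mul_lt (hw : w ∈ CoxParabolic cs J) (hne : w ≠ 1) :
    ∃ i ∈ J, cs.length (cs.simple i * w) < cs.length w := by
  obtain ⟨ω, hω, rfl, hJ⟩ := cs.exists_reduced_of_mem_coxParabolic hw
  cases ω with
  | nil => simp at hne
  | cons i ω =>
    refine ⟨i, hJ i (by simp), ?_⟩
    rw [hω, wordProd_cons, simple_mul_simple_cancel_left, List.length_cons]
    exact Nat.lt_succ_of_le (cs.length_wordProd_le ω)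

theorem sameSide_inv_one_iff [Finite W'] :
    cs.wallSides.SameSide (CoxParabolic cs J) w⁻¹ 1 ↔
      ∀ j ∈ J, cs.length w < cs.length (w * cs.simple j) := by
  have h1 : ∀ t, cs.wallSide 1 t = 0 := fun t => by simpa using cs.wallSide_mul 1 1 t
  have hdesc : ∀ j, cs.wallSide w⁻¹ (cs.simple j) ≠ 0 ↔
      cs.length (w * cs.simple j) < cs.length w := by
    intro j
    rw [wallSide_simple_ne_zero_iff, ← cs.length_inv w, ← cs.length_inv (w * _), mul_inv_rev,
      inv_simple]
  constructor
  · intro h j hj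
    have h₀ : cs.wallSide w⁻¹ (cs.simple j) = 0 :=
      (h _ (cs.simple_mem_coxParabolic hj)).trans (h1 _)
    have h₁ := (hdesc j).not.mp (not_not.mpr h₀)
    have h₂ := cs.length_mul_simple_ne w j
    omega
  · intro h
    obtain ⟨p, hp, hpw⟩ := cs.wallSides.exists_sameSide (CoxParabolic cs J) w⁻¹ 1
    by_cases hp1 : p = 1
    · rwa [hp1, one_mul] at hpw
    · exfalso
      obtain ⟨i, hi, hlt⟩ := cs.exists_length_simple_mul_lt (Subgroup.inv_mem _ hp)
        (inv_ne_one.mpr hp1)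
      have hside := hpw.mul_left_of_mem (Subgroup.inv_mem _ hp) _ (cs.simple_mem_coxParabolic hi)
      rw [inv_mul_cancel_left, mul_one] at hside
      have h₁ := (cs.wallSide_simple_ne_zero_iff p⁻¹ i).mpr hlt
      have h₂ := (hdesc i).mp (ne_of_eq_of_ne hside h₁)
      exact (h i hi).not_gt h₂

end CoxeterSystem

theorem Subgroup.mul_smul_eq_smul_iff {G : Type*} [Group G] (H : Subgroup G) (u w : G) :
    (u * w) • (H : Set G) = w • (H : Set G) ↔ w⁻¹ * u * w ∈ H := by
  rw [leftCoset_eq_iff, ← H.inv_mem_iff, mul_inv_rev, inv_inv, mul_assoc]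

theorem sum_ncard_fixed_eq_ncard_distinguishedPairs (cs : CoxeterSystem M W) (I J : Finset B) :
    ∑ u ∈ CoxX cs I, ((CoxX cs J).filter fun w =>
        (u * w) • (CoxParabolic cs J : Set W) = w • (CoxParabolic cs J : Set W)).card =
      (cs.wallSides.distinguishedPairs (CoxParabolic cs I) (CoxParabolic cs J)).ncard := by
  rw [← Finset.card_sigma, ← Set.ncard_coe_finset]
  refine Set.ncard_congr (fun r _ => (r.1, r.2)) ?_ ?_ ?_
  · rintro ⟨u, w⟩ h
    simpa [WallSides.distinguishedPairs, CoxX, cs.sameSide_inv_one_iff,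
      Subgroup.mul_smul_eq_smul_iff, and_assoc] using h
  · rintro ⟨_, _⟩ ⟨_, _⟩ _ _ h
    simp_all
  · rintro ⟨u, w⟩ h
    refine ⟨⟨u, w⟩, ?_, rfl⟩
    simpa [WallSides.distinguishedPairs, CoxX, cs.sameSide_inv_one_iff,
      Subgroup.mul_smul_eq_smul_iff, and_assoc] using h

/-- Symmetry of Solomon's homomorphism on basis elements, stated combinatorially:
`Φ(x_I)(x_J) = Φ(x_J)(x_I)`, i.e. summing the permutation-character values
`Ind_{W_J}^W 1 (u)` over `u ∈ X_I` is symmetric in `I` and `J`. -/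
theorem solomon_symmetry (cs : CoxeterSystem M W) (I J : Finset B) :
    ∑ u ∈ CoxX cs I, ((CoxX cs J).filter fun w =>
        (u * w) • (CoxParabolic cs J : Set W) = w • (CoxParabolic cs J : Set W)).card =
      ∑ u ∈ CoxX cs J, ((CoxX cs I).filter fun w =>
        (u * w) • (CoxParabolic cs I : Set W) = w • (CoxParabolic cs I : Set W)).card := by
  rw [sum_ncard_fixed_eq_ncard_distinguishedPairs, sum_ncard_fixed_eq_ncard_distinguishedPairs]
  exact cs.isGate_coxParabolic.ncard_distinguishedPairs_comm cs.isGate_coxParabolic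
end

section
/- Let (Wₙ, Sₙ) be a finite Coxeter system of type Bₙ (n ≥ 1), i.e., the hyperoctahedral group with its standard simple reflections. Then for every proper subset J ⊊ Sₙ, D_J = Σ_{w ∈ X_J} (-1)^{l(w)} = 0; consequently Σ_{J ⊆ Sₙ} (-1)^{|J|} D_J = (-1)ⁿ. -/
open scoped Classical Pointwise

variable {B : Type*} [Fintype B]
variable {W : Type*} [Group W] [Fintype W]
variable {M : CoxeterMatrix B}

/-- The signed coordinate permutation of `ℕ → ℤ` attached to the `i`-th simple reflection of
type `Bₙ`: a sign change for the last index, an adjacent transposition for the others. -/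
def signedTransposition (n i : ℕ) (x : ℕ → ℤ) (k : ℕ) : ℤ :=
  if i + 1 = n then (if k = i then -x k else x k)
  else if k = i then x (i + 1) else if k = i + 1 then x i else x k

/-- The pairing of a vector with the `i`-th simple root of type `Bₙ`. -/
def simpleRootPairing (n i : ℕ) (x : ℕ → ℤ) : ℤ :=
  if i + 1 = n then x i else x i - x (i + 1)

/-- Changing the sign of the `i`-th coordinate. -/
def signFlip (i : ℕ) (x : ℕ → ℤ) (k : ℕ) : ℤ := if k = i then -x k else x k

theorem typeB_matrix_cases {n : ℕ} {i j : Fin n} (hij : i ≠ j) :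
    (CoxeterMatrix.Bₙ n i j = 2 ∧ (i : ℕ) + 1 ≠ j ∧ (j : ℕ) + 1 ≠ i) ∨
    (CoxeterMatrix.Bₙ n i j = 3 ∧
      ((i : ℕ) + 1 = j ∧ (j : ℕ) + 1 ≠ n ∨ (j : ℕ) + 1 = i ∧ (i : ℕ) + 1 ≠ n)) ∨
    (CoxeterMatrix.Bₙ n i j = 4 ∧
      ((i : ℕ) + 1 = j ∧ (j : ℕ) + 1 = n ∨ (j : ℕ) + 1 = i ∧ (i : ℕ) + 1 = n)) := by
  have h : CoxeterMatrix.Bₙ n i j = if i = j then 1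
      else (if (i : ℕ) = n - 1 ∧ (j : ℕ) = n - 2 ∨ (j : ℕ) = n - 1 ∧ (i : ℕ) = n - 2 then 4
        else (if (j : ℕ) + 1 = i ∨ (i : ℕ) + 1 = j then 3 else 2)) := rfl
  have h' : (i : ℕ) ≠ j := fun e => hij (Fin.ext e)
  have hi := i.2
  have hj := j.2
  rw [h, if_neg hij]
  split_ifs <;> omega

theorem signedTransposition_comp_self (n i : ℕ) (x : ℕ → ℤ) :
    signedTransposition n i (signedTransposition n i x) = x := by
  funext k
  unfold signedTransposition
  grind

theorem signedTransposition_comm {n i j : ℕ} (hi : i < n) (hij : i ≠ j)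
    (h₁ : i + 1 ≠ j) (h₂ : j + 1 ≠ i) (x : ℕ → ℤ) :
    signedTransposition n i (signedTransposition n j x) =
      signedTransposition n j (signedTransposition n i x) := by
  funext k
  unfold signedTransposition
  grind

theorem signedTransposition_braid_three {n i : ℕ} (hi : i + 2 < n) (x : ℕ → ℤ) :
    signedTransposition n i (signedTransposition n (i + 1) (signedTransposition n i x)) =
      signedTransposition n (i + 1)
        (signedTransposition n i (signedTransposition n (i + 1) x)) := by
  funext k
  unfold signedTransposition
  grind

theorem signedTransposition_braid_four (i : ℕ) (x : ℕ → ℤ) :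
    signedTransposition (i + 2) i (signedTransposition (i + 2) (i + 1)
      (signedTransposition (i + 2) i (signedTransposition (i + 2) (i + 1) x))) =
    signedTransposition (i + 2) (i + 1) (signedTransposition (i + 2) i
      (signedTransposition (i + 2) (i + 1) (signedTransposition (i + 2) i x))) := by
  funext k
  unfold signedTransposition
  grind

/-- `signedTransposition` as an element of the monoid of self-maps of `ℕ → ℤ`. -/
def signedTranspositionEnd (n i : ℕ) : Function.End (ℕ → ℤ) := signedTransposition n i

theorem signedTransposition_isLiftable (n : ℕ) :
    (CoxeterMatrix.Bₙ n).IsLiftable (fun i : Fin n => signedTranspositionEnd n i) := by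
  have sq : ∀ i, signedTranspositionEnd n i * signedTranspositionEnd n i = 1 :=
    fun i => funext fun x => signedTransposition_comp_self n i x
  have cancel : ∀ i u, signedTranspositionEnd n i * (signedTranspositionEnd n i * u) = u :=
    fun i u => by rw [← mul_assoc, sq, one_mul]
  have braid_three : ∀ {i j : ℕ}, i + 1 = j → j + 1 < n →
      signedTranspositionEnd n i * (signedTranspositionEnd n j * signedTranspositionEnd n i) =
      signedTranspositionEnd n j * (signedTranspositionEnd n i * signedTranspositionEnd n j) := by
    rintro i _ rfl h
    exact funext fun x => signedTransposition_braid_three h x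
  have braid_four : ∀ {i j : ℕ}, i + 1 = j → j + 1 = n →
      signedTranspositionEnd n i * (signedTranspositionEnd n j *
        (signedTranspositionEnd n i * signedTranspositionEnd n j)) =
      signedTranspositionEnd n j * (signedTranspositionEnd n i *
        (signedTranspositionEnd n j * signedTranspositionEnd n i)) := by
    rintro i _ rfl rfl
    exact funext fun x => signedTransposition_braid_four i x
  intro i j
  have hi := i.2
  have hj := j.2
  by_cases hij : i = j
  · subst hij
    rw [CoxeterMatrix.diagonal, pow_one]
    exact sq i
  have hij' : (i : ℕ) ≠ j := fun e => hij (Fin.ext e)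
  rcases typeB_matrix_cases hij with ⟨h, h₁, h₂⟩ | ⟨h, ⟨h₁, h₂⟩ | ⟨h₁, h₂⟩⟩ |
    ⟨h, ⟨h₁, h₂⟩ | ⟨h₁, h₂⟩⟩ <;> rw [h]
  · have comm : signedTranspositionEnd n i * signedTranspositionEnd n j =
        signedTranspositionEnd n j * signedTranspositionEnd n i :=
      funext fun x => signedTransposition_comm hi hij' h₁ h₂ x
    rw [pow_two]
    nth_rewrite 1 [comm]
    rw [mul_assoc, cancel, sq]
  · have e := braid_three h₁ (by omega)
    simp only [pow_succ, pow_zero, one_mul, mul_assoc]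
    rw [← e]
    simp only [cancel, sq]
  · have e := braid_three h₁ (by omega)
    simp only [pow_succ, pow_zero, one_mul, mul_assoc]
    rw [e]
    simp only [cancel, sq]
  · have e := braid_four h₁ h₂
    simp only [pow_succ, pow_zero, one_mul, mul_assoc]
    rw [e]
    simp only [cancel, sq]
  · have e := braid_four h₁ h₂
    simp only [pow_succ, pow_zero, one_mul, mul_assoc]
    rw [← e]
    simp only [cancel, sq]

theorem simpleRootPairing_signedTransposition_self {n i : ℕ} (x : ℕ → ℤ) :
    simpleRootPairing n i (signedTransposition n i x) = -simpleRootPairing n i x := by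
  unfold simpleRootPairing signedTransposition
  grind

/-- The value of `simpleRootPairing` after a simple reflection is governed by the Cartan matrix. -/
theorem exists_simpleRootPairing_signedTransposition {n : ℕ} {i j : Fin n} (hij : i ≠ j) :
    ∃ c d : ℤ,
      (∀ x, simpleRootPairing n i (signedTransposition n j x) =
        simpleRootPairing n i x + c * simpleRootPairing n j x) ∧
      (∀ x, simpleRootPairing n j (signedTransposition n i x) =
        simpleRootPairing n j x + d * simpleRootPairing n i x) ∧
      (CoxeterMatrix.Bₙ n i j = 2 ∧ c = 0 ∧ d = 0 ∨
        CoxeterMatrix.Bₙ n i j = 3 ∧ c = 1 ∧ d = 1 ∨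
        CoxeterMatrix.Bₙ n i j = 4 ∧ c = 1 ∧ d = 2 ∨
        CoxeterMatrix.Bₙ n i j = 4 ∧ c = 2 ∧ d = 1) := by
  have h' : (i : ℕ) ≠ j := fun e => hij (Fin.ext e)
  have hi := i.2
  have hj := j.2
  unfold simpleRootPairing signedTransposition
  rcases typeB_matrix_cases hij with ⟨h, h₁, h₂⟩ | ⟨h, ⟨h₁, h₂⟩ | ⟨h₁, h₂⟩⟩ |
    ⟨h, ⟨h₁, h₂⟩ | ⟨h₁, h₂⟩⟩
  · exact ⟨0, 0, by grind, by grind, by simp [h]⟩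
  · exact ⟨1, 1, by grind, by grind, by simp [h]⟩
  · exact ⟨1, 1, by grind, by grind, by simp [h]⟩
  · exact ⟨2, 1, by grind, by grind, by simp [h]⟩
  · exact ⟨1, 2, by grind, by grind, by simp [h]⟩

section

variable {n : ℕ} {W : Type*} [Group W] (cs : CoxeterSystem (CoxeterMatrix.Bₙ n) W)

/-- The orbit map of the dominant regular vector `(n, n - 1, …, 1)` under the inverse
reflection action of a Coxeter group of type `Bₙ`; its values are signed permutations of it. -/
noncomputable def signedWord (w : W) : ℕ → ℤ :=
  (cs.lift ⟨_, signedTransposition_isLiftable n⟩ w⁻¹ : Function.End (ℕ → ℤ)) fun k : ℕ => (n : ℤ) - k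

theorem signedWord_one : signedWord cs 1 = fun k : ℕ => (n : ℤ) - k := by
  simp only [signedWord, inv_one, map_one]
  rfl

theorem signedWord_mul_simple (w : W) (i : Fin n) :
    signedWord cs (w * cs.simple i) = signedTransposition n i (signedWord cs w) := by
  simp only [signedWord, mul_inv_rev, cs.inv_simple, map_mul, cs.lift_apply_simple]
  rfl

theorem simpleRootPairing_signedWord_pos (w : W) (i : Fin n)
    (h : cs.length w < cs.length (w * cs.simple i)) :
    0 < simpleRootPairing n i (signedWord cs w) := by
  induction hl : cs.length w using Nat.strong_induction_on generalizing w i with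
  | _ l ih =>
  subst hl
  by_cases hw : w = 1
  · subst hw
    have := i.2
    rw [signedWord_one]
    unfold simpleRootPairing
    split_ifs <;> push_cast <;> omega
  obtain ⟨j, hj⟩ := cs.exists_rightDescent_of_ne_one hw
  have hij : i ≠ j := by
    rintro rfl
    exact absurd hj (not_lt.mpr h.le)
  obtain ⟨c, d, hc, hd, hM⟩ := exists_simpleRootPairing_signedTransposition hij
  have up : ∀ (u : W) (k : Fin n), ¬ cs.length u < cs.length (u * cs.simple k) →
      cs.length (u * cs.simple k) + 1 = cs.length u := fun u k hu => by
    rcases cs.length_mul_simple u k with h | h <;> omega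
  have upper : ∀ (u : W) (k : Fin n), cs.length (u * cs.simple k) ≤ cs.length u + 1 :=
    fun u k => by rcases cs.length_mul_simple u k with h | h <;> omega
  have hself := fun k : Fin n => @simpleRootPairing_signedTransposition_self n k
  have pow := cs.simple_mul_simple_pow i j
  set s := cs.simple i with hs
  set t := cs.simple j with ht
  have ss : s * s = 1 := cs.simple_mul_simple_self i
  have tt : t * t = 1 := cs.simple_mul_simple_self j
  have sss : ∀ u, s * (s * u) = u := fun u => by rw [← mul_assoc, ss, one_mul]
  have ttt : ∀ u, t * (t * u) = u := fun u => by rw [← mul_assoc, tt, one_mul]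
  have hj' : cs.length (w * t) + 1 = cs.length w := up w j (not_lt.mpr (le_of_lt hj))
  obtain ⟨w₁, rfl⟩ : ∃ w₁, w = w₁ * t := ⟨w * t, by simp [mul_assoc, tt]⟩
  simp only [mul_assoc, tt, mul_one] at hj'
  have p₁ : 0 < simpleRootPairing n j (signedWord cs w₁) := ih _ (by omega) w₁ j (by rw [← ht]; omega) rfl
  by_cases h₁ : cs.length w₁ < cs.length (w₁ * s)
  · have q₁ := ih _ (by omega) w₁ i h₁ rfl
    rw [signedWord_mul_simple, hc]
    rcases hM with ⟨-, rfl, rfl⟩ | ⟨-, rfl, rfl⟩ | ⟨-, rfl, rfl⟩ | ⟨-, rfl, rfl⟩ <;> linarith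
  replace h₁ := up _ _ h₁
  obtain ⟨w₂, rfl⟩ : ∃ w₂, w₁ = w₂ * s := ⟨w₁ * s, by simp [mul_assoc, ss]⟩
  simp only [← hs, mul_assoc, ss, mul_one] at h₁
  have p₂ : 0 < simpleRootPairing n i (signedWord cs w₂) := ih _ (by omega) w₂ i (by rw [← hs]; omega) rfl
  have b₂ : CoxeterMatrix.Bₙ n i j ≠ 2 := by
    intro h2
    rw [h2] at pow
    have e : w₂ * s * t * s = w₂ * t := by
      have : s * t * s = t := by
        calc s * t * s = (s * t) ^ 2 * t := by simp [pow_succ, mul_assoc, tt]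
          _ = t := by rw [pow, one_mul]
      rw [mul_assoc, mul_assoc, ← mul_assoc s, this]
    rw [e] at h
    have : cs.length (w₂ * t) ≤ _ := upper w₂ j
    omega
  by_cases h₂ : cs.length w₂ < cs.length (w₂ * t)
  · have q₂ := ih _ (by omega) w₂ j h₂ rfl
    rw [signedWord_mul_simple, hc, signedWord_mul_simple, hd, hself]
    rcases hM with ⟨h2, rfl, rfl⟩ | ⟨-, rfl, rfl⟩ | ⟨-, rfl, rfl⟩ | ⟨-, rfl, rfl⟩
    · exact absurd h2 b₂
    all_goals linarith
  replace h₂ := up _ _ h₂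
  obtain ⟨w₃, rfl⟩ : ∃ w₃, w₂ = w₃ * t := ⟨w₂ * t, by simp [mul_assoc, tt]⟩
  simp only [← ht, mul_assoc, tt, mul_one] at h₂
  have p₃ : 0 < simpleRootPairing n j (signedWord cs w₃) := ih _ (by omega) w₃ j (by rw [← ht]; omega) rfl
  have b₃ : CoxeterMatrix.Bₙ n i j ≠ 3 := by
    intro h3
    rw [h3] at pow
    have e : w₃ * t * s * t * s = w₃ * s * t := by
      have : t * s * t * s = s * t := by
        calc t * s * t * s = s * (s * t) ^ 3 * t := by
              simp [pow_succ, mul_assoc, tt, sss]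
          _ = s * t := by rw [pow, mul_one]
      simp only [mul_assoc] at this ⊢
      rw [this]
    rw [e] at h
    have : cs.length (w₃ * s) ≤ _ := upper w₃ i
    have : cs.length (w₃ * s * t) ≤ _ := upper (w₃ * s) j
    omega
  by_cases h₃ : cs.length w₃ < cs.length (w₃ * s)
  · have q₃ := ih _ (by omega) w₃ i h₃ rfl
    rw [signedWord_mul_simple, hc, signedWord_mul_simple, hd, hself, signedWord_mul_simple, hc,
      hself]
    rcases hM with ⟨h2, rfl, rfl⟩ | ⟨h3, rfl, rfl⟩ | ⟨-, rfl, rfl⟩ | ⟨-, rfl, rfl⟩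
    · exact absurd h2 b₂
    · exact absurd h3 b₃
    all_goals linarith
  replace h₃ := up _ _ h₃
  obtain ⟨w₄, rfl⟩ : ∃ w₄, w₃ = w₄ * s := ⟨w₃ * s, by simp [mul_assoc, ss]⟩
  simp only [← hs, mul_assoc, ss, mul_one] at h₃
  have h4 : CoxeterMatrix.Bₙ n i j = 4 := by omega
  rw [h4] at pow
  have e : w₄ * s * t * s * t * s = w₄ * t * s * t := by
    have : s * t * s * t * s = t * s * t := by
      calc s * t * s * t * s = (s * t) ^ 4 * (t * s * t) := by
            simp [pow_succ, mul_assoc, tt, sss, ttt]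
        _ = t * s * t := by rw [pow, one_mul]
    simp only [mul_assoc] at this ⊢
    rw [this]
  rw [e] at h
  have : cs.length (w₄ * t) ≤ _ := upper w₄ j
  have : cs.length (w₄ * t * s) ≤ _ := upper (w₄ * t) i
  have : cs.length (w₄ * t * s * t) ≤ _ := upper (w₄ * t * s) j
  simp only [mul_assoc] at *
  omega

theorem length_lt_length_mul_simple_iff (w : W) (i : Fin n) :
    cs.length w < cs.length (w * cs.simple i) ↔
      0 < simpleRootPairing n i (signedWord cs w) := by
  refine ⟨simpleRootPairing_signedWord_pos cs w i, fun h => ?_⟩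
  by_contra h'
  have := simpleRootPairing_signedWord_pos cs (w * cs.simple i) i (by
    rw [cs.simple_mul_simple_cancel_right]
    have := cs.length_mul_simple_ne w i
    omega)
  rw [signedWord_mul_simple, simpleRootPairing_signedTransposition_self] at this
  omega

theorem natAbs_signedWord_injOn (w : W) :
    Set.InjOn (fun k => (signedWord cs w k).natAbs) (Set.Iio n) := by
  induction w using cs.simple_induction_right with
  | one =>
    intro a ha b hb hab
    simp only [signedWord_one, Set.mem_Iio] at *
    omega
  | mul_simple_right w i ih =>
    have hi := i.2
    intro a ha b hb hab
    have ih' : ∀ a < n, ∀ b < n,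
        (signedWord cs w a).natAbs = (signedWord cs w b).natAbs → a = b :=
      fun a ha b hb => @ih a ha b hb
    simp only [signedWord_mul_simple, Set.mem_Iio] at *
    unfold signedTransposition at hab
    split_ifs at hab <;> (try rw [Int.natAbs_neg] at hab) <;>
      (try rw [Int.natAbs_neg] at hab) <;>
      have := ih' _ (by omega) _ (by omega) hab <;> omega

/-- The sign change at any coordinate is realised by right multiplication by a reflection. -/
theorem exists_isReflection_signFlip {i : ℕ} (hi : i < n) :
    ∃ r : W, cs.IsReflection r ∧
      ∀ w, signedWord cs (w * r) = signFlip i (signedWord cs w) := by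
  induction hd : n - 1 - i generalizing i with
  | zero =>
    refine ⟨cs.simple ⟨i, hi⟩, cs.isReflection_simple _, fun w => ?_⟩
    rw [signedWord_mul_simple]
    funext k
    unfold signedTransposition signFlip
    grind
  | succ d ih =>
    obtain ⟨r, hr, h⟩ := ih (i := i + 1) (by omega) (by omega)
    refine ⟨cs.simple ⟨i, hi⟩ * r * (cs.simple ⟨i, hi⟩)⁻¹, hr.conj _, fun w => ?_⟩
    rw [cs.inv_simple, ← mul_assoc, ← mul_assoc, signedWord_mul_simple, h, signedWord_mul_simple]
    funext k
    unfold signedTransposition signFlip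
    grind

end

theorem natAbs_signFlip (i : ℕ) (x : ℕ → ℤ) (k : ℕ) : (signFlip i x k).natAbs = (x k).natAbs := by
  unfold signFlip
  split_ifs <;> simp

theorem coxD_typeB_eq_zero {n : ℕ} {W : Type*} [Group W] [Fintype W]
    (cs : CoxeterSystem (CoxeterMatrix.Bₙ n) W) {J : Finset (Fin n)} (hJ : J ≠ Finset.univ) :
    CoxD cs J = 0 := by
  obtain ⟨p, hpJ, hp⟩ : ∃ p : Fin n, p ∉ J ∧ ∀ k, p < k → k ∈ J := by
    have hne : (Jᶜ).Nonempty := by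
      rwa [Finset.nonempty_iff_ne_empty, ne_eq, Finset.compl_eq_empty_iff]
    refine ⟨Jᶜ.max' hne, by simpa using Finset.max'_mem _ hne, fun k hk => ?_⟩
    by_contra hkJ
    exact absurd (Finset.le_max' _ k (by simpa using hkJ)) (not_le.mpr hk)
  choose r hr hrw using fun i : Fin n => exists_isReflection_signFlip cs i.2
  have hJp : ∀ j ∈ J, j ≠ p := fun j hj h => hpJ (h ▸ hj)
  let f : W → Fin n → ℕ := fun w k => (signedWord cs w k).natAbs
  let m : (Fin n → ℕ) → Fin n := fun y => Function.argminOn y (Set.Iic p) ⟨p, Set.self_mem_Iic⟩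
  have hm : ∀ y, m y ≤ p := fun y => Set.mem_Iic.1 (Function.argminOn_mem y (Set.Iic p) _)
  have hmin : ∀ y : Fin n → ℕ, ∀ k ≤ p, y (m y) ≤ y k :=
    fun y k hk => Function.argminOn_le y (Set.Iic p) (Set.mem_Iic.2 hk)
  have hf : ∀ w i, f (w * r i) = f w := fun w i => by
    funext k
    simp only [f, hrw, natAbs_signFlip]
  refine Finset.sum_involution (fun w _ => w * r (m (f w))) ?_ ?_ ?_ ?_
  · intro w _
    have h₁ := cs.length_mul_mod_two w (r (m (f w)))
    have h₂ := (hr (m (f w))).odd_length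
    rcases Nat.even_or_odd (cs.length w) with hw | hw
    · have : Odd (cs.length (w * r (m (f w)))) := by grind
      rw [hw.neg_one_pow, this.neg_one_pow]
      norm_num
    · have : Even (cs.length (w * r (m (f w)))) := by grind
      rw [hw.neg_one_pow, this.neg_one_pow]
      norm_num
  · intro w _ _ h
    exact (hr (m (f w))).length_mul_left_ne w (congrArg cs.length h)
  · intro w hw
    simp only [CoxX, Finset.mem_filter, Finset.mem_univ, true_and,
      length_lt_length_mul_simple_iff, hrw] at hw ⊢
    intro j hj
    have hwj := hw j hj
    have hjp : (j : ℕ) ≠ p := fun h => hJp j hj (Fin.ext h)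
    have hi : (m (f w) : ℕ) ≤ p := hm (f w)
    have hle : ∀ k : ℕ, k ≤ p →
        (signedWord cs w (m (f w))).natAbs ≤ (signedWord cs w k).natAbs :=
      fun k hk => hmin (f w) ⟨k, hk.trans_lt p.2⟩ hk
    have hinj : ∀ a < n, ∀ b < n,
        (signedWord cs w a).natAbs = (signedWord cs w b).natAbs → a = b :=
      fun a ha b hb => @natAbs_signedWord_injOn n W _ cs w a ha b hb
    generalize m (f w) = i at *
    generalize signedWord cs w = x at *
    have hjn := j.2
    have hpn := p.2
    unfold simpleRootPairing signFlip at *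
    by_cases hjlt : (j : ℕ) < p
    · have h₁ := hle j (by omega)
      have h₂ := hle (j + 1) (by omega)
      have h₃ := hinj i (by omega) j (by omega)
      have h₄ := hinj i (by omega) (j + 1) (by omega)
      have h₅ : (j : ℕ) = i → x j = x i := congrArg x
      have h₆ : (j : ℕ) + 1 = i → x (j + 1) = x i := congrArg x
      split_ifs at hwj ⊢ <;> omega
    · split_ifs at hwj ⊢ <;> omega
  · intro w _
    simp only [hf, mul_assoc, (hr _).mul_self, mul_one]

theorem coxD_univ {B W : Type*} [Fintype B] [Group W] [Fintype W] {M : CoxeterMatrix B}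
    (cs : CoxeterSystem M W) : CoxD cs Finset.univ = 1 := by
  have h : CoxX cs Finset.univ = {1} := by
    ext w
    simp only [CoxX, Finset.mem_filter, Finset.mem_univ, true_and, true_implies,
      Finset.mem_singleton]
    constructor
    · intro h
      by_contra hw
      obtain ⟨i, hi⟩ := cs.exists_rightDescent_of_ne_one hw
      exact absurd hi (not_lt.mpr (h i).le)
    · rintro rfl
      simp
  simp [CoxD, h]

/-- **(Tan).** In a Coxeter system of type `Bₙ` (`n ≥ 1`), `D_J = 0` for every proper
subset `J ⊊ Sₙ`; consequently `Σ_{J ⊆ Sₙ} (-1)^{|J|} D_J = (-1)ⁿ`. -/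
theorem typeB_coxD_vanishes (n : ℕ) (hn : 1 ≤ n) {W : Type*} [Group W] [Fintype W]
    (cs : CoxeterSystem (CoxeterMatrix.Bₙ n) W) :
    (∀ J : Finset (Fin n), J ≠ Finset.univ → CoxD cs J = 0) ∧
      ∑ J : Finset (Fin n), (-1 : ℤ) ^ J.card * CoxD cs J = (-1) ^ n := by
  refine ⟨fun J hJ => coxD_typeB_eq_zero cs hJ, ?_⟩
  rw [Finset.sum_eq_single Finset.univ
    (fun J _ hJ => by rw [coxD_typeB_eq_zero cs hJ, mul_zero]) (by simp), coxD_univ]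
  simp
end
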